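/- A finite simple graph G = (V,E) with |V| ≥ 2 has the property that for every generic edge-length assignment λ : E → ℝ_{>0} the set of congruence classes of plane realizations of G inducing λ is finite and nonempty, if and only if G satisfies the Laman conditions, i.e., |E| = 2|V| − 3 and every subgraph (V′,E′) of G with |V′| ≥ 2 satisfies |E′| ≤ 2|V′| − 3. -/

import Mathlib

/-- A finite simple graph: vertices are a finite set of naturals, edges are
two-element subsets of the vertex set. -/
structure GeoGraph where
  V : Finset ℕ
  E : Finset (Finset ℕ)
  edge_sub : ∀ e ∈ E, e ⊆ V
  edge_two : ∀ e ∈ E, e.card = 2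

def IsSubgraph (G' G : GeoGraph) : Prop :=
  G'.V ⊆ G.V ∧ G'.E ⊆ G.E

/-- The Laman conditions: `|E| = 2|V| - 3` and every subgraph with at least two
vertices satisfies `|E'| ≤ 2|V'| - 3`. -/
def Laman (G : GeoGraph) : Prop :=
  2 ≤ G.V.card ∧ G.E.card = 2 * G.V.card - 3 ∧
    ∀ G' : GeoGraph, IsSubgraph G' G → 2 ≤ G'.V.card → G'.E.card ≤ 2 * G'.V.card - 3

/-- A generic edge-length assignment: positive real edge lengths that are
algebraically independent over ℚ. -/
def Generic (G : GeoGraph) (lam : Finset ℕ → ℝ) : Prop :=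
  (∀ e ∈ G.E, 0 < lam e) ∧
    AlgebraicIndependent ℚ (fun e : G.E => lam e.1)

/-- A spherical realization: every vertex goes to the complex sphere. -/
def SphereRealization (G : GeoGraph) (ρ : ℕ → Fin 3 → ℂ) : Prop :=
  ∀ v ∈ G.V, ∑ i, ρ v i ^ 2 = 1

/-- A realization induces the edge lengths `lam`. -/
def SphereInduces (G : GeoGraph) (ρ : ℕ → Fin 3 → ℂ) (lam : Finset ℕ → ℝ) : Prop :=
  ∀ u v : ℕ, ({u, v} : Finset ℕ) ∈ G.E →
    ∑ i, (ρ u i - ρ v i) ^ 2 = (lam {u, v} : ℂ)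

/-- Congruence of spherical realizations via `SO₃(ℂ)`. -/
def SphereCongruent (G : GeoGraph) (ρ ρ' : ℕ → Fin 3 → ℂ) : Prop :=
  ∃ A : Matrix (Fin 3) (Fin 3) ℂ, A * A.transpose = 1 ∧ A.det = 1 ∧
    ∀ v ∈ G.V, ρ' v = A.mulVec (ρ v)

/-- Congruence classes of spherical realizations of `G` inducing `lam`. -/
def SphereClasses (G : GeoGraph) (lam : Finset ℕ → ℝ) : Type :=
  Quot fun ρ ρ' : {ρ : ℕ → Fin 3 → ℂ // SphereRealization G ρ ∧ SphereInduces G ρ lam} =>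
    SphereCongruent G ρ.1 ρ'.1

def PlaneInduces (G : GeoGraph) (ρ : ℕ → Fin 2 → ℂ) (lam : Finset ℕ → ℝ) : Prop :=
  ∀ u v : ℕ, ({u, v} : Finset ℕ) ∈ G.E →
    ∑ i, (ρ u i - ρ v i) ^ 2 = (lam {u, v} : ℂ)

/-- Congruence of plane realizations via `SO₂(ℂ)` and a translation. -/
def PlaneCongruent (G : GeoGraph) (ρ ρ' : ℕ → Fin 2 → ℂ) : Prop :=
  ∃ A : Matrix (Fin 2) (Fin 2) ℂ, ∃ b : Fin 2 → ℂ, A * A.transpose = 1 ∧ A.det = 1 ∧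
    ∀ v ∈ G.V, ρ' v = A.mulVec (ρ v) + b

/-- Congruence classes of plane realizations of `G` inducing `lam`. -/
def PlaneClasses (G : GeoGraph) (lam : Finset ℕ → ℝ) : Type :=
  Quot fun ρ ρ' : {ρ : ℕ → Fin 2 → ℂ // PlaneInduces G ρ lam} =>
    PlaneCongruent G ρ.1 ρ'.1

/-- A calligraph: `{0,1,2} ⊆ V`, `{1,2} ∈ E`, `|E| = 2|V| - 4`, and adding the
edge `{0,1}` or the edge `{0,2}` yields a graph satisfying the Laman conditions. -/
def Calligraph (H : GeoGraph) : Prop :=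
  ({0, 1, 2} : Finset ℕ) ⊆ H.V ∧ ({1, 2} : Finset ℕ) ∈ H.E ∧
    H.E.card = 2 * H.V.card - 4 ∧
    ((∃ H' : GeoGraph, H'.V = H.V ∧ H'.E = insert {0, 1} H.E ∧ Laman H') ∨
     (∃ H' : GeoGraph, H'.V = H.V ∧ H'.E = insert {0, 2} H.E ∧ Laman H'))

/-- A split of `G` into two subgraphs sharing exactly the vertices `0,1,2` and
the edge `{1,2}`. -/
def IsSplit (G G₁ G₂ : GeoGraph) : Prop :=
  G.V = G₁.V ∪ G₂.V ∧ G.E = G₁.E ∪ G₂.E ∧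
    G₁.V ∩ G₂.V = ({0, 1, 2} : Finset ℕ) ∧
    G₁.E ∩ G₂.E = ({{1, 2}} : Finset (Finset ℕ))

/-- A calligraphic split: a split into two calligraphs. -/
def CalligraphicSplit (G G₁ G₂ : GeoGraph) : Prop :=
  IsSplit G G₁ G₂ ∧ Calligraph G₁ ∧ Calligraph G₂


/-- The relative algebraic closure of `ℚ(s)` inside `ℂ`. -/
noncomputable def algHull (s : Set ℂ) : IntermediateField ℚ ℂ :=
  ((Subalgebra.algebraicClosure (Algebra.adjoin ℚ s) ℂ).restrictScalars ℚ).toIntermediateField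
    fun _ hx => IsAlgebraic.inv hx

theorem coe_algHull (s : Set ℂ) :
    (algHull s : Set ℂ) = (AlgebraicIndependent.matroid ℚ ℂ).closure s := by
  rw [AlgebraicIndependent.matroid_closure_eq]; rfl

theorem subset_algHull (s : Set ℂ) : s ⊆ algHull s := by
  rw [coe_algHull]; exact Matroid.subset_closure _ _

theorem AlgebraicIndependent.matroid_indep_range {ι : Type*} {x : ι → ℂ}
    (hx : AlgebraicIndependent ℚ x) : (AlgebraicIndependent.matroid ℚ ℂ).Indep (Set.range x) :=
  AlgebraicIndependent.matroid_indep_iff.2 hx.to_subtype_range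

theorem AlgebraicIndependent.encard_range {ι : Type*} [Finite ι] {x : ι → ℂ}
    (hx : AlgebraicIndependent ℚ x) : (Set.range x).encard = Nat.card ι := by
  rw [← Set.image_univ, hx.injective.encard_image, Set.encard_univ, ENat.card_eq_coe_natCard]

theorem AlgebraicIndependent.card_le_of_mem_algHull {ι : Type*} [Finite ι] {x : ι → ℂ}
    (hx : AlgebraicIndependent ℚ x) {s : Set ℂ} (hs : ∀ i, x i ∈ algHull s) :
    (Nat.card ι : ℕ∞) ≤ s.encard := by
  have hsub : Set.range x ⊆ (AlgebraicIndependent.matroid ℚ ℂ).closure s := by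
    rw [← coe_algHull]; rintro _ ⟨i, rfl⟩; exact hs i
  have := hx.matroid_indep_range.encard_le_eRk_of_subset hsub
  rw [Matroid.eRk_closure_eq, hx.encard_range] at this
  exact this.trans (Matroid.eRk_le_encard _ _)

theorem AlgebraicIndependent.subset_algHull_range {ι : Type*} [Finite ι] {x : ι → ℂ}
    (hx : AlgebraicIndependent ℚ x) {s : Set ℂ} (hs : ∀ i, x i ∈ algHull s)
    (hcard : s.encard ≤ Nat.card ι) : s ⊆ algHull (Set.range x) := by
  intro y hy
  by_contra hyx
  have hyI : AlgebraicIndependent ℚ (fun o : Option ι => o.elim y x) :=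
    (hx.option_iff_transcendental y).2 hyx
  have h := hyI.card_le_of_mem_algHull (s := s)
    (by rintro (_ | i); exacts [subset_algHull s hy, hs i])
  have := h.trans hcard
  simp at this
  norm_cast at this
  omega

theorem Set.Finite.countable_adjoin_rat {A : Type} [CommRing A] [Algebra ℚ A] {s : Set A}
    (hs : s.Finite) : Countable (Algebra.adjoin ℚ s) := by
  have := hs.to_subtype
  have hc : Countable (MvPolynomial s ℚ) := by
    rw [← Cardinal.mk_le_aleph0_iff]
    exact MvPolynomial.cardinalMk_le_max.trans (by simp)
  rw [Algebra.adjoin_eq_range]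
  exact (MvPolynomial.aeval ((↑) : s → A) :
    MvPolynomial s ℚ →ₐ[ℚ] A).rangeRestrict_surjective.countable

theorem countable_algHull {s : Set ℂ} (hs : s.Finite) : (algHull s : Set ℂ).Countable := by
  have := hs.countable_adjoin_rat
  exact Algebraic.countable (Algebra.adjoin ℚ s) ℂ

open Cardinal in
theorem AlgebraicIndependent.exists_extension {ι : Type} [Finite ι] {x : ι → ℂ}
    (hx : AlgebraicIndependent ℚ x) :
    ∃ y : ι ⊕ ℂ → ℂ, IsTranscendenceBasis ℚ y ∧ ∀ i, y (.inl i) = x i := by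
  classical
  obtain ⟨B, hxB, hB⟩ := exists_isTranscendenceBasis_superset hx.to_subtype_range
  have hcard : #ℂ = #B := IsAlgClosed.cardinal_eq_cardinal_transcendence_basis_of_aleph0_lt'
    _ hB (by simp) (by simpa using Cardinal.aleph0_lt_continuum)
  have hfin : (Set.range x).Finite := Set.finite_range x
  have hdiff : #(B \ Set.range x : Set ℂ) = #ℂ := by
    have h1 := Cardinal.mk_sdiff_add_mk hxB
    rw [← hcard] at h1
    have hinf : ℵ₀ ≤ #ℂ := by simpa using Cardinal.aleph0_le_continuum
    have h2 : #(Set.range x) < ℵ₀ := hfin.lt_aleph0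
    exact (Cardinal.eq_of_add_eq_of_aleph0_le ((add_comm _ _).trans h1)
      (h2.trans_le hinf) hinf)
  obtain ⟨e⟩ := Cardinal.eq.1 hdiff
  let e' : ι ⊕ ℂ ≃ B :=
    ((Equiv.ofInjective x hx.injective).sumCongr e.symm).trans (Equiv.Set.sumDiffSubset hxB)
  refine ⟨fun i => e' i, ?_, fun i => ?_⟩
  · exact (isTranscendenceBasis_equiv e').2 hB
  · simp [e']

theorem IsTranscendenceBasis.exists_ringEquiv {ι : Type} {x y : ι → ℂ}
    (hx : IsTranscendenceBasis ℚ x) (hy : IsTranscendenceBasis ℚ y) :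
    ∃ σ : ℂ ≃+* ℂ, ∀ i, σ (x i) = y i := by
  let := IsAlgClosed.isAlgClosure_of_transcendence_basis x hx
  let := IsAlgClosed.isAlgClosure_of_transcendence_basis y hy
  let e : Algebra.adjoin ℚ (Set.range x) ≃+* Algebra.adjoin ℚ (Set.range y) :=
    (hx.1.aevalEquiv.symm.trans hy.1.aevalEquiv).toRingEquiv
  refine ⟨IsAlgClosure.equivOfEquiv ℂ ℂ e, fun i => ?_⟩
  let xi : Algebra.adjoin ℚ (Set.range x) := ⟨x i, Algebra.subset_adjoin ⟨i, rfl⟩⟩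
  have h1 : hx.1.aevalEquiv (MvPolynomial.X i) = xi := by ext; simp [xi]
  have h2 : e xi = hy.1.aevalEquiv (MvPolynomial.X i) := by
    simp [e, ← h1]
  have := IsAlgClosure.equivOfEquiv_algebraMap ℂ ℂ e xi
  rw [h2] at this
  refine this.trans ?_
  exact (hy.1.algebraMap_aevalEquiv _).trans (by simp)

/-- Any two finite algebraically independent families in `ℂ` are conjugate under `Aut(ℂ)`. -/
theorem AlgebraicIndependent.exists_ringEquiv {ι : Type} [Finite ι] {x y : ι → ℂ}
    (hx : AlgebraicIndependent ℚ x) (hy : AlgebraicIndependent ℚ y) :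
    ∃ σ : ℂ ≃+* ℂ, ∀ i, σ (x i) = y i := by
  obtain ⟨x', hx', hxx⟩ := hx.exists_extension
  obtain ⟨y', hy', hyy⟩ := hy.exists_extension
  obtain ⟨σ, hσ⟩ := hx'.exists_ringEquiv hy'
  exact ⟨σ, fun i => by rw [← hxx, ← hyy, hσ]⟩

open Cardinal in
theorem exists_pos_algebraicIndependent (ι : Type) [Finite ι] :
    ∃ x : ι → ℝ, (∀ i, 0 < x i) ∧ AlgebraicIndependent ℚ x := by
  have halg : Algebra.IsAlgebraic (Algebra.adjoin ℚ (Set.Ioi (0 : ℝ))) ℝ := by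
    refine ⟨fun x => ?_⟩
    have hp : ∀ y : ℝ, 0 < y → IsAlgebraic (Algebra.adjoin ℚ (Set.Ioi (0 : ℝ))) y := fun y hy =>
      isAlgebraic_algebraMap (⟨y, Algebra.subset_adjoin hy⟩ : Algebra.adjoin ℚ (Set.Ioi (0 : ℝ)))
    have : x = (|x| + 1) - (|x| + 1 - x) := by ring
    rw [this]
    exact (hp _ (by positivity)).sub (hp _ (by linarith [le_abs_self x]))
  obtain ⟨t, ht, hB⟩ := exists_isTranscendenceBasis_subset (R := ℚ) (Set.Ioi (0 : ℝ))
  have hinf : t.Infinite := by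
    intro hfin
    have := hB.isAlgebraic
    rw [Subtype.range_coe] at this
    have hc := hfin.countable_adjoin_rat
    have hle := Algebra.IsAlgebraic.cardinalMk_le_max (Algebra.adjoin ℚ t) ℝ
    have : #ℝ ≤ ℵ₀ := hle.trans (max_le Cardinal.mk_le_aleph0 le_rfl)
    rw [Cardinal.mk_real] at this
    exact (Cardinal.aleph0_lt_continuum.not_ge this)
  have := hinf.to_subtype
  obtain ⟨f⟩ : Nonempty (ι ↪ t) := by
    cases nonempty_fintype ι
    exact ⟨(Fintype.equivFin ι).toEmbedding.trans
      (Fin.valEmbedding.trans (Infinite.natEmbedding t))⟩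
  exact ⟨fun i => f i, fun i => ht (f i).2, hB.1.comp f f.injective⟩

/-- A complex affine algebraic set with countably many points is finite. -/
theorem finite_zeroLocus_of_countable {τ : Type*} [Finite τ] (I : Ideal (MvPolynomial τ ℂ))
    (hI : (MvPolynomial.zeroLocus ℂ I).Countable) : (MvPolynomial.zeroLocus ℂ I).Finite := by
  by_cases htop : I = ⊤
  · subst htop
    simp
  have : Nontrivial (MvPolynomial τ ℂ ⧸ I) := Ideal.Quotient.nontrivial_iff.2 htop
  obtain ⟨s, g, ginj, gfin⟩ := exists_finite_inj_algHom_of_fg ℂ (MvPolynomial τ ℂ ⧸ I)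
  rcases s with _ | s
  · have hfin : Module.Finite ℂ (MvPolynomial τ ℂ ⧸ I) := by
      have h0 : (algebraMap ℂ (MvPolynomial (Fin 0) ℂ)).Finite :=
        RingHom.Finite.of_surjective _ (MvPolynomial.C_surjective (Fin 0))
      have := RingHom.Finite.comp (g := g.toRingHom) gfin h0
      rw [show g.toRingHom.comp (algebraMap ℂ _) = algebraMap ℂ _ from g.comp_algebraMap] at this
      exact RingHom.finite_algebraMap.1 this
    let F : MvPolynomial.zeroLocus ℂ I → (MvPolynomial τ ℂ ⧸ I →ₐ[ℂ] ℂ) := fun x =>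
      Ideal.Quotient.liftₐ I (MvPolynomial.aeval x.1) fun p hp => x.2 p hp
    have hF : Function.Injective F := by
      intro x y hxy
      ext i
      have := DFunLike.congr_fun hxy (Ideal.Quotient.mk I (MvPolynomial.X i))
      simpa [F] using this
    exact Set.finite_coe_iff.1 (Finite.of_injective F hF)
  · exfalso
    obtain ⟨q, hq⟩ := Ideal.Quotient.mk_surjective (g (MvPolynomial.X 0))
    have hsurj : ∀ c : ℂ, ∃ x ∈ MvPolynomial.zeroLocus ℂ I, MvPolynomial.aeval x q = c := by
      intro c
      let P : Ideal (MvPolynomial (Fin (s + 1)) ℂ) :=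
        RingHom.ker (MvPolynomial.aeval (fun _ => c) : MvPolynomial (Fin (s + 1)) ℂ →ₐ[ℂ] ℂ)
      have hP : P.IsPrime := RingHom.ker_isPrime _
      algebraize [g.toRingHom]
      have hint : Algebra.IsIntegral (MvPolynomial (Fin (s + 1)) ℂ) (MvPolynomial τ ℂ ⧸ I) :=
        ⟨RingHom.Finite.to_isIntegral gfin⟩
      obtain ⟨Q, -, hQ, hQP⟩ := Ideal.exists_ideal_over_prime_of_isIntegral P
        (⊥ : Ideal (MvPolynomial τ ℂ ⧸ I)) (by
          intro p hp
          have : p = 0 := ginj ((Ideal.mem_bot.1 (Ideal.mem_comap.1 hp)).trans (map_zero g).symm)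
          simp [this])
      obtain ⟨N, hN, hle⟩ := Ideal.exists_le_maximal (Q.comap (Ideal.Quotient.mk I))
        (hQ.comap _).ne_top
      obtain ⟨x, rfl⟩ := MvPolynomial.isMaximal_iff_eq_vanishingIdeal_singleton.1 hN
      refine ⟨x, fun p hp => ?_, ?_⟩
      · refine (MvPolynomial.mem_vanishingIdeal_singleton_iff x p).1 (hle ?_)
        rw [Ideal.mem_comap, Ideal.Quotient.eq_zero_iff_mem.2 hp]
        exact Q.zero_mem
      · have hmem : q - MvPolynomial.C c ∈ Q.comap (Ideal.Quotient.mk I) := by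
          have h1 : MvPolynomial.X 0 - MvPolynomial.C c ∈ P := by
            simp [P, RingHom.mem_ker]
          rw [← hQP, Ideal.mem_comap] at h1
          rw [Ideal.mem_comap, map_sub, hq]
          convert h1 using 1
          change _ = g _
          rw [map_sub]
          congr 1
          exact (g.commutes c).symm
        have := (MvPolynomial.mem_vanishingIdeal_singleton_iff x _).1 (hle hmem)
        simpa [sub_eq_zero] using this
    have := (hI.image fun x => MvPolynomial.aeval x q).mono
      (fun c _ => hsurj c : Set.univ ⊆ _)
    exact not_countable_complex this

/-- The edges of `E` spanned by a vertex set `S`. -/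
def spannedEdges (E : Finset (Finset ℕ)) (S : Finset ℕ) : Finset (Finset ℕ) :=
  E.filter (· ⊆ S)

theorem mem_spannedEdges {E : Finset (Finset ℕ)} {S e : Finset ℕ} :
    e ∈ spannedEdges E S ↔ e ∈ E ∧ e ⊆ S := Finset.mem_filter

/-- The Laman sparsity count. -/
def LamanSparse (E : Finset (Finset ℕ)) : Prop :=
  ∀ S : Finset ℕ, 2 ≤ S.card → (spannedEdges E S).card + 3 ≤ 2 * S.card

theorem LamanSparse.mono {E F : Finset (Finset ℕ)} (hF : LamanSparse F) (h : E ⊆ F) :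
    LamanSparse E := fun S hS =>
  (Nat.add_le_add_right (Finset.card_le_card (Finset.filter_subset_filter _ h)) 3).trans (hF S hS)

theorem card_spannedEdges_add_le (E : Finset (Finset ℕ)) (S T : Finset ℕ) :
    (spannedEdges E S).card + (spannedEdges E T).card ≤
      (spannedEdges E (S ∪ T)).card + (spannedEdges E (S ∩ T)).card := by
  rw [← Finset.card_union_add_card_inter]
  refine Nat.add_le_add (Finset.card_le_card fun e he => ?_) (Finset.card_le_card fun e he => ?_)
  · rw [Finset.mem_union, mem_spannedEdges, mem_spannedEdges] at he
    rw [mem_spannedEdges]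
    rcases he with he | he
    exacts [⟨he.1, he.2.trans Finset.subset_union_left⟩, ⟨he.1, he.2.trans Finset.subset_union_right⟩]
  · rw [Finset.mem_inter, mem_spannedEdges, mem_spannedEdges] at he
    exact mem_spannedEdges.2 ⟨he.1.1, Finset.subset_inter he.1.2 he.2.2⟩

/-- A vertex set spanning at least as many edges as sparsity allows. -/
def Tight (E : Finset (Finset ℕ)) (S : Finset ℕ) : Prop :=
  2 * S.card ≤ (spannedEdges E S).card + 3

theorem Tight.union {E : Finset (Finset ℕ)} (hE : LamanSparse E) {S T : Finset ℕ}
    (hS : Tight E S) (hT : Tight E T) (h : 2 ≤ (S ∩ T).card) : Tight E (S ∪ T) := by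
  have h1 := card_spannedEdges_add_le E S T
  have h2 := hE _ h
  have h3 := Finset.card_union_add_card_inter S T
  unfold Tight at *
  omega

theorem Tight.union_three {E : Finset (Finset ℕ)} (h2 : ∀ e ∈ E, e.card = 2)
    {R S T : Finset ℕ} (hR : Tight E R) (hS : Tight E S) (hT : Tight E T)
    (hRS : (R ∩ S).card = 1) (hRT : (R ∩ T).card < 2) (hST : (S ∩ T).card < 2)
    (hU : 2 ≤ ((R ∪ S) ∩ T).card) : Tight E (R ∪ S ∪ T) := by
  have hempty : ∀ W : Finset ℕ, W.card < 2 → spannedEdges E W = ∅ := fun W hW => by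
    refine Finset.eq_empty_of_forall_notMem fun e he => ?_
    rw [mem_spannedEdges] at he
    have := Finset.card_le_card he.2
    have := h2 e he.1
    omega
  have hedge : (spannedEdges E R).card + (spannedEdges E S).card + (spannedEdges E T).card ≤
      (spannedEdges E (R ∪ S ∪ T)).card := by
    have h1 := card_spannedEdges_add_le E R S
    rw [hempty (R ∩ S) (by omega), Finset.card_empty] at h1
    have hdisj : Disjoint (spannedEdges E R ∪ spannedEdges E S) (spannedEdges E T) := by
      rw [Finset.disjoint_union_left]
      constructor
      all_goals
        rw [Finset.disjoint_left]
        intro e he he'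
        rw [mem_spannedEdges] at he he'
        have := Finset.card_le_card (Finset.subset_inter he.2 he'.2)
        have := h2 e he.1
        omega
    have hdisj' : Disjoint (spannedEdges E R) (spannedEdges E S) := by
      rw [Finset.disjoint_left]
      intro e he he'
      rw [mem_spannedEdges] at he he'
      have := Finset.card_le_card (Finset.subset_inter he.2 he'.2)
      have := h2 e he.1
      omega
    rw [← Finset.card_union_of_disjoint hdisj', ← Finset.card_union_of_disjoint hdisj]
    refine Finset.card_le_card fun e he => ?_
    simp only [Finset.mem_union, mem_spannedEdges] at he ⊢
    rcases he with (he | he) | he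
    · exact ⟨he.1, he.2.trans (Finset.subset_union_left.trans Finset.subset_union_left)⟩
    · exact ⟨he.1, he.2.trans (Finset.subset_union_right.trans Finset.subset_union_left)⟩
    · exact ⟨he.1, he.2.trans Finset.subset_union_right⟩
  have h3 := Finset.card_union_add_card_inter R S
  have h4 := Finset.card_union_add_card_inter (R ∪ S) T
  unfold Tight at *
  omega

theorem exists_tight_of_not_insert {E : Finset (Finset ℕ)} (hE : LamanSparse E)
    {a b v : ℕ} (hab : a ≠ b) (hv : ∀ e ∈ E, v ∉ e) (hav : a ≠ v) (hbv : b ≠ v)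
    (h : {a, b} ∉ E → ¬ LamanSparse (insert {a, b} E)) :
    ∃ S, a ∈ S ∧ b ∈ S ∧ v ∉ S ∧ Tight E S := by
  by_cases hmem : ({a, b} : Finset ℕ) ∈ E
  · refine ⟨{a, b}, by simp, by simp, by simp [hav.symm, hbv.symm], ?_⟩
    have : 0 < (spannedEdges E {a, b}).card :=
      Finset.card_pos.2 ⟨{a, b}, mem_spannedEdges.2 ⟨hmem, subset_rfl⟩⟩
    rw [Tight, Finset.card_pair hab]
    omega
  · have hns := h hmem
    unfold LamanSparse at hns
    push Not at hns
    obtain ⟨S, hS, hlt⟩ := hns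
    have hSE := hE S hS
    by_cases hsub : ({a, b} : Finset ℕ) ⊆ S
    · have hins : (spannedEdges (insert {a, b} E) S).card ≤ (spannedEdges E S).card + 1 := by
        unfold spannedEdges
        rw [Finset.filter_insert, if_pos hsub]
        exact Finset.card_insert_le _ _
      have haS : a ∈ S := hsub (by simp)
      have hbS : b ∈ S := hsub (by simp)
      refine ⟨S, haS, hbS, fun hvS => ?_, by unfold Tight; omega⟩
      have h1 : 2 ≤ (S.erase v).card := by
        rw [← Finset.card_pair hab]
        refine Finset.card_le_card fun x hx => ?_
        have : x = a ∨ x = b := by simpa using hx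
        rcases this with rfl | rfl
        exacts [Finset.mem_erase.2 ⟨hav, haS⟩, Finset.mem_erase.2 ⟨hbv, hbS⟩]
      have h2 := hE _ h1
      have h3 : spannedEdges E S ⊆ spannedEdges E (S.erase v) := fun e he => by
        rw [mem_spannedEdges] at he ⊢
        exact ⟨he.1, fun x hx => Finset.mem_erase.2
          ⟨fun hxv => hv e he.1 (hxv ▸ hx), he.2 hx⟩⟩
      have h4 := Finset.card_le_card h3
      have h5 := Finset.card_erase_add_one hvS
      omega
    · exfalso
      unfold spannedEdges at hlt hSE
      rw [Finset.filter_insert, if_neg hsub] at hlt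
      omega

theorem exists_sparse_insert {E : Finset (Finset ℕ)} {a b c v : ℕ}
    (h2 : ∀ e ∈ E, e.card = 2) (hab : a ≠ b) (hac : a ≠ c) (hbc : b ≠ c)
    (hav : a ≠ v) (hbv : b ≠ v) (hcv : c ≠ v) (hv : ∀ e ∈ E, v ∉ e)
    (hE : LamanSparse (insert {v, a} (insert {v, b} (insert {v, c} E)))) :
    ({a, b} ∉ E ∧ LamanSparse (insert {a, b} E)) ∨
    ({b, c} ∉ E ∧ LamanSparse (insert {b, c} E)) ∨
    ({a, c} ∉ E ∧ LamanSparse (insert {a, c} E)) := by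
  have hE' : LamanSparse E := hE.mono ((Finset.subset_insert _ _).trans
    ((Finset.subset_insert _ _).trans (Finset.subset_insert _ _)))
  have key : ∀ S, a ∈ S → b ∈ S → c ∈ S → v ∉ S → ¬ Tight E S := by
    intro S ha hb hc hvS ht
    have h1 : 2 ≤ (insert v S).card := by
      rw [Finset.card_insert_of_notMem hvS]
      have := Finset.card_pos.2 ⟨a, ha⟩
      omega
    have hlt := hE _ h1
    have hpair : ∀ x y : ℕ, x ≠ y → ({v, x} : Finset ℕ) ≠ {v, y} ∨ x = v := by
      intro x y hxy
      by_contra! hcon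
      have : x ∈ ({v, y} : Finset ℕ) := hcon.1 ▸ (by simp)
      simp [hxy, hcon.2] at this
    have hnot : ∀ x, ({v, x} : Finset ℕ) ∉ E := fun x hx => hv _ hx (by simp)
    have hsub : insert {v, a} (insert {v, b} (insert {v, c} (spannedEdges E S))) ⊆
        spannedEdges (insert {v, a} (insert {v, b} (insert {v, c} E))) (insert v S) := by
      intro e he
      simp only [Finset.mem_insert, mem_spannedEdges] at he ⊢
      rcases he with rfl | rfl | rfl | he
      · exact ⟨by simp, by simp [Finset.insert_subset_iff, ha]⟩
      · exact ⟨by simp, by simp [Finset.insert_subset_iff, hb]⟩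
      · exact ⟨by simp, by simp [Finset.insert_subset_iff, hc]⟩
      · exact ⟨by simp [he.1], he.2.trans (Finset.subset_insert _ _)⟩
    have hcard := Finset.card_le_card hsub
    rw [Finset.card_insert_of_notMem, Finset.card_insert_of_notMem,
      Finset.card_insert_of_notMem] at hcard
    · rw [Finset.card_insert_of_notMem hvS] at hlt
      unfold Tight at ht
      omega
    · simp [mem_spannedEdges, hnot]
    · have := hpair b c hbc
      simp [mem_spannedEdges, hnot]
      tauto
    · have h3 := hpair a b hab
      have h4 := hpair a c hac
      simp [mem_spannedEdges, hnot]
      tauto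
  by_contra! hcon
  obtain ⟨R, haR, hbR, hvR, hR⟩ := exists_tight_of_not_insert hE' hab hv hav hbv hcon.1
  obtain ⟨S, hbS, hcS, hvS, hS⟩ := exists_tight_of_not_insert hE' hbc hv hbv hcv hcon.2.1
  obtain ⟨T, haT, hcT, hvT, hT⟩ := exists_tight_of_not_insert hE' hac hv hav hcv hcon.2.2
  by_cases hRS : 2 ≤ (R ∩ S).card
  · exact key _ (by simp [haR]) (by simp [hbR]) (by simp [hcS]) (by simp [hvR, hvS])
      (hR.union hE' hS hRS)
  by_cases hRT : 2 ≤ (R ∩ T).card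
  · exact key _ (by simp [haR]) (by simp [hbR]) (by simp [hcT]) (by simp [hvR, hvT])
      (hR.union hE' hT hRT)
  by_cases hST : 2 ≤ (S ∩ T).card
  · exact key _ (by simp [haT]) (by simp [hbS]) (by simp [hcS]) (by simp [hvS, hvT])
      (hS.union hE' hT hST)
  have hpos : 0 < (R ∩ S).card := Finset.card_pos.2 ⟨b, by simp [hbR, hbS]⟩
  refine key _ (by simp [haR]) (by simp [hbR]) (by simp [hcS]) (by simp [hvR, hvS, hvT])
    (hR.union_three h2 hS hT (by omega) (by omega) (by omega) ?_)
  rw [← Finset.card_pair hac]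
  refine Finset.card_le_card fun x hx => ?_
  have : x = a ∨ x = c := by simpa using hx
  rcases this with rfl | rfl
  · simp [haR, haT]
  · simp [hcS, hcT]

theorem exists_low_degree {V : Finset ℕ} {E : Finset (Finset ℕ)} (hV : 2 ≤ V.card)
    (hsub : ∀ e ∈ E, e ⊆ V) (h2 : ∀ e ∈ E, e.card = 2) (hE : LamanSparse E) :
    ∃ v ∈ V, (E.filter (v ∈ ·)).card ≤ 3 := by
  by_contra! hcon
  have h1 : ∑ v ∈ V, (E.filter (v ∈ ·)).card = 2 * E.card := by
    simp_rw [Finset.card_filter]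
    rw [Finset.sum_comm, mul_comm, ← smul_eq_mul, ← Finset.sum_const]
    refine Finset.sum_congr rfl fun e he => ?_
    rw [← Finset.card_filter, Finset.filter_mem_eq_inter, Finset.inter_eq_right.2 (hsub e he),
      h2 e he]
  have h3 := Finset.card_nsmul_le_sum V (fun v => (E.filter (v ∈ ·)).card) 4 hcon
  have h4 := hE V hV
  have h5 : spannedEdges E V = E := Finset.filter_true_of_mem hsub
  rw [h5] at h4
  rw [h1, smul_eq_mul] at h3
  omega

open Topology

/-- The difference between the value of `z` at `v` and at the other endpoint of the edge `e`,
and zero if `v` does not belong to `e`. -/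
def edgeDiff {R : Type*} [CommRing R] (z : ℕ → R) (e : Finset ℕ) (v : ℕ) : R :=
  if v ∈ e then 2 * z v - ∑ u ∈ e, z u else 0

section edgeDiff

variable {R : Type*} [CommRing R]

theorem edgeDiff_of_notMem (z : ℕ → R) {e : Finset ℕ} {v : ℕ} (h : v ∉ e) :
    edgeDiff z e v = 0 := if_neg h

theorem edgeDiff_pair (z : ℕ → R) {u v : ℕ} (h : u ≠ v) (x : ℕ) :
    edgeDiff z {u, v} x = if x = u then z u - z v else if x = v then z v - z u else 0 := by
  unfold edgeDiff
  rw [Finset.sum_pair h]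
  split_ifs <;> simp_all <;> ring

theorem edgeDiff_congr {z z' : ℕ → R} {e : Finset ℕ} (h : ∀ u ∈ e, z u = z' u) (v : ℕ) :
    edgeDiff z e v = edgeDiff z' e v := by
  unfold edgeDiff
  split_ifs with hv
  · rw [h v hv, Finset.sum_congr rfl h]
  · rfl

theorem edgeDiff_update (z : ℕ → R) {e : Finset ℕ} {v : ℕ} (h : v ∉ e) (t : R) (x : ℕ) :
    edgeDiff (Function.update z v t) e x = edgeDiff z e x :=
  edgeDiff_congr (fun _ hu => Function.update_of_ne (ne_of_mem_of_not_mem hu h) _ _) x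

end edgeDiff

/-- The framework with coordinates `z`, `w` carries no nonzero self-stress on the edges `E`. -/
def StressFree (E : Finset (Finset ℕ)) (z w : ℕ → ℝ) : Prop :=
  ∀ ω : Finset ℕ → ℝ, (∀ v, ∑ e ∈ E, ω e * edgeDiff z e v = 0) →
    (∀ v, ∑ e ∈ E, ω e * edgeDiff w e v = 0) → ∀ e ∈ E, ω e = 0

theorem StressFree.mono {E F : Finset (Finset ℕ)} {z w : ℕ → ℝ} (hF : StressFree F z w)
    (h : E ⊆ F) : StressFree E z w := by
  classical
  intro ω hz hw e he
  have key : ∀ (y : ℕ → ℝ) (v : ℕ), ∑ e ∈ F, (if e ∈ E then ω e else 0) * edgeDiff y e v =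
      ∑ e ∈ E, ω e * edgeDiff y e v := fun y v => by
    simp_rw [ite_mul, zero_mul]
    rw [← Finset.sum_filter, Finset.filter_mem_eq_inter, Finset.inter_eq_right.2 h]
  have := hF (fun e => if e ∈ E then ω e else 0) (fun v => (key z v).trans (hz v))
    (fun v => (key w v).trans (hw v)) e (h he)
  simpa [he] using this

/-- The rows of the rigidity matrix. -/
def rigidityRow (V : Finset ℕ) (E : Finset (Finset ℕ)) (z w : ℕ → ℝ) (e : E) (v : V) : ℝ × ℝ :=
  (edgeDiff w e.1 v.1, edgeDiff z e.1 v.1)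

theorem stressFree_iff_linearIndependent {V : Finset ℕ} {E : Finset (Finset ℕ)} {z w : ℕ → ℝ}
    (hsub : ∀ e ∈ E, e ⊆ V) :
    StressFree E z w ↔ LinearIndependent ℝ (rigidityRow V E z w) := by
  classical
  rw [Fintype.linearIndependent_iff]
  constructor
  · intro h g hg e
    have key : ∀ v : V, (∑ e : E, g e * edgeDiff w e.1 v.1, ∑ e : E, g e * edgeDiff z e.1 v.1) =
        ((0, 0) : ℝ × ℝ) := by
      intro v
      have := congrFun hg v
      simpa [Finset.sum_apply, rigidityRow, Prod.ext_iff, Prod.fst_sum, Prod.snd_sum] using this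
    have aux : ∀ y : ℕ → ℝ, (∀ v : V, ∑ e : E, g e * edgeDiff y e.1 v.1 = 0) → ∀ v,
        ∑ e ∈ E, (if h : e ∈ E then g ⟨e, h⟩ else 0) * edgeDiff y e v = 0 := by
      intro y hy v
      by_cases hv : v ∈ V
      · rw [← hy ⟨v, hv⟩, ← Finset.sum_coe_sort]
        simp
      · exact Finset.sum_eq_zero fun e he => by
          rw [edgeDiff_of_notMem _ fun h => hv (hsub e he h), mul_zero]
    simpa using h (fun e => if h : e ∈ E then g ⟨e, h⟩ else 0)
      (aux z fun v => (Prod.ext_iff.1 (key v)).2) (aux w fun v => (Prod.ext_iff.1 (key v)).1)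
      e.1 e.2
  · intro h ω hz hw e he
    refine h (fun e => ω e.1) ?_ ⟨e, he⟩
    funext v
    have h1 := hz v.1
    have h2 := hw v.1
    rw [← Finset.sum_coe_sort] at h1 h2
    simpa [Finset.sum_apply, rigidityRow, Prod.ext_iff, Prod.fst_sum, Prod.snd_sum]
      using And.intro h2 h1

theorem StressFree.eventually {E : Finset (Finset ℕ)} {z w : ℕ → ℝ} (h : StressFree E z w)
    (p q : ℕ → ℝ) : ∀ᶠ s in 𝓝 (0 : ℝ), StressFree E (z + s • p) (w + s • q) := by
  have hsub : ∀ e ∈ E, e ⊆ E.sup id := fun e he => Finset.le_sup (f := id) he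
  simp_rw [stressFree_iff_linearIndependent hsub] at h ⊢
  have hc : Continuous fun s : ℝ => rigidityRow (E.sup id) E (z + s • p) (w + s • q) := by
    refine continuous_pi fun e => continuous_pi fun v => ?_
    unfold rigidityRow edgeDiff
    simp only [Pi.add_apply, Pi.smul_apply]
    refine Continuous.prodMk ?_ ?_ <;> split_ifs <;> fun_prop
  refine hc.continuousAt.eventually (p := fun g => LinearIndependent ℝ g) ?_
  simpa using h.eventually

theorem StressFree.exists_ne {E : Finset (Finset ℕ)} {z w : ℕ → ℝ} (h : StressFree E z w)
    {a b : ℕ} (hab : a ≠ b) : ∃ z w, StressFree E z w ∧ z a ≠ z b := by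
  obtain ⟨s, hs, hne⟩ := ((infinite_of_mem_nhds _ (h.eventually (Pi.single b 1) 0)).sdiff
    (Set.finite_singleton (z a - z b))).nonempty
  refine ⟨_, _, hs, fun hc => hne ?_⟩
  simp [hab] at hc
  simp [hc]

theorem StressFree.exists_det_ne_zero {E : Finset (Finset ℕ)} {z w : ℕ → ℝ}
    (h : StressFree E z w) {a b c : ℕ} (hab : a ≠ b) (hac : a ≠ c) (hbc : b ≠ c) :
    ∃ z w, StressFree E z w ∧
      (z b - z a) * (w c - w a) - (z c - z a) * (w b - w a) ≠ 0 := by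
  have hfin : {s : ℝ | (z b + s - z a) * (w c + s - w a) - (z c - z a) * (w b - w a) = 0}.Finite := by
    by_contra hinf
    obtain ⟨r, hr⟩ := Set.Infinite.nonempty hinf
    refine hinf ((Set.toFinite {r, z a - z b + (w a - w c) - r}).subset fun s hs => ?_)
    have : (s - r) * (s - (z a - z b + (w a - w c) - r)) = 0 := by
      simp only [Set.mem_ofPred_eq] at hr hs
      linear_combination hs - hr
    rcases mul_eq_zero.1 this with h | h
    · exact Or.inl (sub_eq_zero.1 h)
    · exact Or.inr (sub_eq_zero.1 h)
  obtain ⟨s, hs, hne⟩ := ((infinite_of_mem_nhds _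
    (h.eventually (Pi.single b 1) (Pi.single c 1))).sdiff hfin).nonempty
  refine ⟨_, _, hs, fun hc => hne ?_⟩
  simpa [hab, hac, hbc, hbc.symm] using hc

theorem StressFree.exists_insert_two {E : Finset (Finset ℕ)} {z w : ℕ → ℝ}
    (h : StressFree E z w) {a b v : ℕ} (hab : a ≠ b) (hav : a ≠ v) (hbv : b ≠ v)
    (hv : ∀ e ∈ E, v ∉ e) :
    ∃ z w, StressFree (insert {v, a} (insert {v, b} E)) z w := by
  obtain ⟨z, w, h, hz⟩ := h.exists_ne hab
  refine ⟨Function.update z v (z a), Function.update w v (w a + 1), fun ω h1 h2 => ?_⟩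
  have hnb : ({v, b} : Finset ℕ) ∉ E := fun h => hv _ h (by simp)
  have hna : ({v, a} : Finset ℕ) ∉ insert ({v, b} : Finset ℕ) E := by
    rw [Finset.mem_insert, not_or]
    refine ⟨fun h => ?_, fun h => hv _ h (by simp)⟩
    have : a ∈ ({v, b} : Finset ℕ) := h ▸ by simp
    simp [hab, hav] at this
  have hE : ∀ (y : ℕ → ℝ) (t : ℝ) (x : ℕ),
      ∑ e ∈ E, ω e * edgeDiff (Function.update y v t) e x = ∑ e ∈ E, ω e * edgeDiff y e x :=
    fun y t x => Finset.sum_congr rfl fun e he => by rw [edgeDiff_update _ (hv e he)]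
  have hEv : ∀ y : ℕ → ℝ, ∑ e ∈ E, ω e * edgeDiff y e v = 0 :=
    fun y => Finset.sum_eq_zero fun e he => by rw [edgeDiff_of_notMem _ (hv e he), mul_zero]
  simp only [Finset.sum_insert hna, Finset.sum_insert hnb, hE, edgeDiff_pair _ hav.symm,
    edgeDiff_pair _ hbv.symm] at h1 h2
  have e1 := h1 v
  have e2 := h2 v
  simp only [hEv, if_true, Function.update_self, Function.update_of_ne hav,
    Function.update_of_ne hbv] at e1 e2
  have hb : ω {v, b} = 0 := by
    have : ω {v, b} * (z a - z b) = 0 := by linear_combination e1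
    exact (mul_eq_zero.1 this).resolve_right (sub_ne_zero.2 hz)
  have ha : ω {v, a} = 0 := by rw [hb] at e2; linear_combination e2
  simp only [ha, hb, zero_mul, zero_add] at h1 h2
  intro e he
  rw [Finset.mem_insert, Finset.mem_insert] at he
  rcases he with rfl | rfl | he
  exacts [ha, hb, h ω h1 h2 e he]

theorem StressFree.exists_insert_three {E : Finset (Finset ℕ)} {z w : ℕ → ℝ} {a b c v : ℕ}
    (h : StressFree (insert {a, b} E) z w) (hab : a ≠ b) (hac : a ≠ c) (hbc : b ≠ c)
    (hav : a ≠ v) (hbv : b ≠ v) (hcv : c ≠ v) (habE : {a, b} ∉ E) (hv : ∀ e ∈ E, v ∉ e) :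
    ∃ z w, StressFree (insert {v, a} (insert {v, b} (insert {v, c} E))) z w := by
  obtain ⟨z, w, h, hdet⟩ := h.exists_det_ne_zero hab hac hbc
  refine ⟨Function.update z v ((z a + z b) / 2), Function.update w v ((w a + w b) / 2),
    fun ω h1 h2 => ?_⟩
  have hne : ∀ x y : ℕ, x ≠ y → x ≠ v → ({v, x} : Finset ℕ) ≠ {v, y} := fun x y hxy hxv h => by
    have : x ∈ ({v, y} : Finset ℕ) := h ▸ by simp
    simp [hxy, hxv] at this
  have hnE : ∀ x : ℕ, ({v, x} : Finset ℕ) ∉ E := fun x h => hv _ h (by simp)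
  have hnb : ({v, b} : Finset ℕ) ∉ insert ({v, c} : Finset ℕ) E := by
    simp [hne b c hbc hbv, hnE]
  have hna : ({v, a} : Finset ℕ) ∉ insert ({v, b} : Finset ℕ) (insert ({v, c} : Finset ℕ) E) := by
    simp [hne a b hab hav, hne a c hac hav, hnE]
  have hE : ∀ (y : ℕ → ℝ) (t : ℝ) (x : ℕ),
      ∑ e ∈ E, ω e * edgeDiff (Function.update y v t) e x = ∑ e ∈ E, ω e * edgeDiff y e x :=
    fun y t x => Finset.sum_congr rfl fun e he => by rw [edgeDiff_update _ (hv e he)]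
  have hEv : ∀ y : ℕ → ℝ, ∑ e ∈ E, ω e * edgeDiff y e v = 0 :=
    fun y => Finset.sum_eq_zero fun e he => by rw [edgeDiff_of_notMem _ (hv e he), mul_zero]
  simp only [Finset.sum_insert hna, Finset.sum_insert hnb, Finset.sum_insert (hnE c), hE,
    edgeDiff_pair _ hav.symm, edgeDiff_pair _ hbv.symm, edgeDiff_pair _ hcv.symm,
    Function.update_self, Function.update_of_ne hav, Function.update_of_ne hbv,
    Function.update_of_ne hcv] at h1 h2
  have e1 := h1 v
  have e2 := h2 v
  simp only [hEv, if_true] at e1 e2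
  have hc : ω {v, c} = 0 := by
    have : ω {v, c} * ((z b - z a) * (w c - w a) - (z c - z a) * (w b - w a)) = 0 := by
      linear_combination (w b - w a) * e1 - (z b - z a) * e2
    exact (mul_eq_zero.1 this).resolve_right hdet
  have hba : ω {v, b} = ω {v, a} := by
    rw [hc] at e1 e2
    have h3 : (ω {v, b} - ω {v, a}) * (z b - z a) = 0 := by linear_combination -2 * e1
    have h4 : (ω {v, b} - ω {v, a}) * (w b - w a) = 0 := by linear_combination -2 * e2
    by_contra hcon
    have hcon := sub_ne_zero.2 hcon
    apply hdet
    rw [(mul_eq_zero.1 h3).resolve_left hcon, (mul_eq_zero.1 h4).resolve_left hcon]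
    ring
  have hstress : ∀ y : ℕ → ℝ,
      (∀ x, ω {v, a} * (if x = v then (y a + y b) / 2 - y a
          else if x = a then y a - (y a + y b) / 2 else 0) +
        (ω {v, b} * (if x = v then (y a + y b) / 2 - y b
          else if x = b then y b - (y a + y b) / 2 else 0) +
        (ω {v, c} * (if x = v then (y a + y b) / 2 - y c
          else if x = c then y c - (y a + y b) / 2 else 0) +
        ∑ e ∈ E, ω e * edgeDiff y e x)) = 0) →
      ∀ x, ∑ e ∈ insert {a, b} E, Function.update ω {a, b} (ω {v, a} / 2) e * edgeDiff y e x = 0 := by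
    intro y hy x
    rw [Finset.sum_insert habE, Function.update_self, edgeDiff_pair _ hab]
    have : ∑ e ∈ E, Function.update ω {a, b} (ω {v, a} / 2) e * edgeDiff y e x =
        ∑ e ∈ E, ω e * edgeDiff y e x := Finset.sum_congr rfl fun e he => by
      rw [Function.update_of_ne (ne_of_mem_of_not_mem he habE)]
    rw [this]
    have hyx := hy x
    rw [hc, hba] at hyx
    by_cases hxv : x = v
    · subst hxv
      simp [hEv, hav.symm, hbv.symm]
    · rw [if_neg hxv, if_neg hxv] at hyx
      by_cases hxa : x = a
      · subst hxa
        simp only [if_true, hab, if_false] at hyx ⊢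
        linear_combination hyx
      · by_cases hxb : x = b
        · subst hxb
          simp only [if_true, hxa, if_false] at hyx ⊢
          linear_combination hyx
        · simp only [hxa, hxb, if_false] at hyx ⊢
          linear_combination hyx
  have hω := h _ (hstress z h1) (hstress w h2)
  have ha : ω {v, a} = 0 := by
    have := hω {a, b} (by simp)
    rw [Function.update_self] at this
    linarith
  intro e he
  simp only [Finset.mem_insert] at he
  rcases he with rfl | rfl | rfl | he
  · exact ha
  · rw [hba, ha]
  · exact hc
  · have := hω e (Finset.mem_insert_of_mem he)
    rwa [Function.update_of_ne (ne_of_mem_of_not_mem he habE)] at this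

theorem exists_neighbors {E : Finset (Finset ℕ)} (h2 : ∀ e ∈ E, e.card = 2) (v : ℕ) :
    ∃ N : Finset ℕ, v ∉ N ∧ N.card = (E.filter (v ∈ ·)).card ∧
      E.filter (v ∈ ·) = N.image fun x => {v, x} := by
  have himg : E.filter (v ∈ ·) =
      ((E.sup id).filter fun x => x ≠ v ∧ {v, x} ∈ E).image fun x => {v, x} := by
    ext e
    simp only [Finset.mem_filter, Finset.mem_image]
    constructor
    · rintro ⟨he, hve⟩
      obtain ⟨x, y, hxy, rfl⟩ := Finset.card_eq_two.1 (h2 e he)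
      have hle : ({x, y} : Finset ℕ) ⊆ E.sup id := Finset.le_sup (f := id) he
      rcases Finset.mem_insert.1 hve with rfl | hvy
      · exact ⟨y, ⟨hle (by simp), hxy.symm, he⟩, rfl⟩
      · obtain rfl := Finset.mem_singleton.1 hvy
        exact ⟨x, ⟨hle (by simp), hxy, by rwa [Finset.pair_comm]⟩, Finset.pair_comm _ _⟩
    · rintro ⟨x, ⟨-, -, hx⟩, rfl⟩
      exact ⟨hx, by simp⟩
  refine ⟨_, by simp, ?_, himg⟩
  rw [himg, Finset.card_image_of_injOn]
  intro x hx y _ hxy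
  have hx' : x ≠ v := (Finset.mem_filter.1 hx).2.1
  have : x ∈ ({v, y} : Finset ℕ) := (show ({v, x} : Finset ℕ) = {v, y} from hxy) ▸ by simp
  simpa [hx'] using this

/-- Sparse graphs have stress-free realizations, by Henneberg induction. -/
theorem LamanSparse.exists_stressFree {V : Finset ℕ} {E : Finset (Finset ℕ)}
    (hE : LamanSparse E) (hsub : ∀ e ∈ E, e ⊆ V) (h2 : ∀ e ∈ E, e.card = 2) :
    ∃ z w, StressFree E z w := by
  induction V using Finset.strongInduction generalizing E with
  | H V ih =>
    by_cases hV : 2 ≤ V.card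
    swap
    · exact ⟨0, 0, fun _ _ _ e he => absurd (Finset.card_le_card (hsub e he)) (by
        rw [h2 e he]; exact hV)⟩
    obtain ⟨v, hvV, hdeg⟩ := exists_low_degree hV hsub h2 hE
    obtain ⟨N, hvN, hcard, hN⟩ := exists_neighbors h2 v
    obtain ⟨E', hE'⟩ : ∃ E', E' = E.filter (v ∉ ·) := ⟨_, rfl⟩
    have hvE' : ∀ e ∈ E', v ∉ e := fun e he => by
      rw [hE', Finset.mem_filter] at he
      exact he.2
    have hunion : E = (N.image fun x => {v, x}) ∪ E' := by
      rw [← hN, hE', Finset.filter_union_filter_not_eq]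
    have hE'E : E' ⊆ E := hE' ▸ Finset.filter_subset _ _
    have hsub' : ∀ e ∈ E', e ⊆ V.erase v := fun e he =>
      Finset.subset_erase.2 ⟨hsub e (hE'E he), hvE' e he⟩
    have h2' : ∀ e ∈ E', e.card = 2 := fun e he => h2 e (hE'E he)
    rcases hdeg.lt_or_eq with hlt | heq
    · obtain ⟨z, w, h⟩ := ih _ (Finset.erase_ssubset hvV)
        (hE.mono hE'E) hsub' h2'
      obtain ⟨M, hM, hM3⟩ := Infinite.exists_superset_card_eq (insert v N) 3
        (by rw [Finset.card_insert_of_notMem hvN]; omega)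
      have hMv : (M.erase v).card = 2 := by
        rw [Finset.card_erase_of_mem (hM (by simp)), hM3]
      obtain ⟨a, b, hab, hMab⟩ := Finset.card_eq_two.1 hMv
      have hav : a ∈ M.erase v := by simp [hMab]
      have hbv : b ∈ M.erase v := by simp [hMab]
      obtain ⟨z, w, h⟩ := h.exists_insert_two hab (Finset.ne_of_mem_erase hav)
        (Finset.ne_of_mem_erase hbv) hvE'
      refine ⟨z, w, h.mono ?_⟩
      rw [hunion]
      refine Finset.union_subset (fun e he => ?_)
        ((Finset.subset_insert _ _).trans (Finset.subset_insert _ _))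
      obtain ⟨x, hx, rfl⟩ := Finset.mem_image.1 he
      have hx' : x ∈ M.erase v := Finset.mem_erase.2
        ⟨ne_of_mem_of_not_mem hx hvN, hM (Finset.mem_insert_of_mem hx)⟩
      rw [hMab, Finset.mem_insert, Finset.mem_singleton] at hx'
      rcases hx' with rfl | rfl <;> simp
    · rw [heq] at hcard
      obtain ⟨a, b, c, hab, hac, hbc, rfl⟩ := Finset.card_eq_three.1 hcard
      have hins : E = insert {v, a} (insert {v, b} (insert {v, c} E')) := by
        rw [hunion]
        simp [Finset.image_insert, Finset.insert_union]
      simp only [Finset.mem_insert, Finset.mem_singleton, not_or] at hvN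
      obtain ⟨hva : v ≠ a, hvb : v ≠ b, hvc : v ≠ c⟩ := hvN
      have hmemV : ∀ x, {v, x} ∈ E → v ≠ x → x ∈ V.erase v := fun x hx hvx =>
        Finset.mem_erase.2 ⟨hvx.symm, hsub _ hx (by simp)⟩
      have haV := hmemV a (by rw [hins]; simp) hva
      have hbV := hmemV b (by rw [hins]; simp) hvb
      have hcV := hmemV c (by rw [hins]; simp) hvc
      have step : ∀ {x y : ℕ}, x ≠ y → x ∈ V.erase v → y ∈ V.erase v →
          LamanSparse (insert {x, y} E') → ∃ z w, StressFree (insert {x, y} E') z w := by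
        intro x y hxy hx hy hxyE
        refine ih _ (Finset.erase_ssubset hvV) hxyE ?_ ?_
        · intro e he
          rcases Finset.mem_insert.1 he with rfl | he
          · simp only [Finset.insert_subset_iff, Finset.singleton_subset_iff]
            exact ⟨hx, hy⟩
          · exact hsub' e he
        · intro e he
          rcases Finset.mem_insert.1 he with rfl | he
          · exact Finset.card_pair hxy
          · exact h2' e he
      have hE2 := hE
      rw [hins] at hE2
      rcases exists_sparse_insert h2' hab hac hbc hva.symm hvb.symm hvc.symm hvE' hE2 with
        ⟨hn, hs⟩ | ⟨hn, hs⟩ | ⟨hn, hs⟩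
      · obtain ⟨z, w, h⟩ := step hab haV hbV hs
        obtain ⟨z, w, h⟩ := h.exists_insert_three hab hac hbc hva.symm hvb.symm hvc.symm hn hvE'
        exact ⟨z, w, hins ▸ h⟩
      · obtain ⟨z, w, h⟩ := step hbc hbV hcV hs
        obtain ⟨z, w, h⟩ := h.exists_insert_three hbc hab.symm hac.symm hvb.symm hvc.symm hva.symm
          hn hvE'
        refine ⟨z, w, h.mono ?_⟩
        rw [hins]
        intro e
        simp only [Finset.mem_insert]
        tauto
      · obtain ⟨z, w, h⟩ := step hac haV hcV hs
        obtain ⟨z, w, h⟩ := h.exists_insert_three hac hab hbc.symm hva.symm hvc.symm hvb.symm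
          hn hvE'
        refine ⟨z, w, h.mono ?_⟩
        rw [hins]
        intro e
        simp only [Finset.mem_insert]
        tauto

/-- The squared length of the edge `e`, in isotropic coordinates. -/
def sqLen {R : Type*} [CommRing R] (z w : ℕ → R) (e : Finset ℕ) : R :=
  2 * ∑ u ∈ e, z u * w u - (∑ u ∈ e, z u) * ∑ u ∈ e, w u

section sqLen

variable {R : Type*} [CommRing R]

theorem sqLen_pair (z w : ℕ → R) {u v : ℕ} (h : u ≠ v) :
    sqLen z w {u, v} = (z u - z v) * (w u - w v) := by
  simp only [sqLen, Finset.sum_pair h]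
  ring

theorem sqLen_congr {z z' w w' : ℕ → R} {e : Finset ℕ} (hz : ∀ u ∈ e, z u = z' u)
    (hw : ∀ u ∈ e, w u = w' u) : sqLen z w e = sqLen z' w' e := by
  unfold sqLen
  rw [Finset.sum_congr rfl hz, Finset.sum_congr rfl hw,
    Finset.sum_congr rfl fun u hu => by rw [hz u hu, hw u hu]]

theorem map_sqLen {S : Type*} [CommRing S] (f : R →+* S) (z w : ℕ → R) (e : Finset ℕ) :
    f (sqLen z w e) = sqLen (fun v => f (z v)) (fun v => f (w v)) e := by
  simp only [sqLen, map_sub, map_mul, map_sum, map_ofNat]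

theorem sqLen_comm (z w : ℕ → R) (e : Finset ℕ) : sqLen z w e = sqLen w z e := by
  simp only [sqLen, mul_comm]

theorem sqLen_add_left (z z' w : ℕ → R) (e : Finset ℕ) :
    sqLen (z + z') w e = sqLen z w e + sqLen z' w e := by
  simp only [sqLen, Pi.add_apply, add_mul, Finset.sum_add_distrib]
  ring

theorem sqLen_smul_left (c : R) (z w : ℕ → R) (e : Finset ℕ) :
    sqLen (c • z) w e = c * sqLen z w e := by
  simp only [sqLen, Pi.smul_apply, smul_eq_mul, mul_assoc, ← Finset.mul_sum]
  ring

theorem sqLen_add_right (z w w' : ℕ → R) (e : Finset ℕ) :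
    sqLen z (w + w') e = sqLen z w e + sqLen z w' e := by
  simp only [sqLen_comm z, sqLen_add_left]

theorem sqLen_smul_right (c : R) (z w : ℕ → R) (e : Finset ℕ) :
    sqLen z (c • w) e = c * sqLen z w e := by
  simp only [sqLen_comm z, sqLen_smul_left]

theorem sqLen_single_left (v : ℕ) (w : ℕ → R) (e : Finset ℕ) :
    sqLen (Pi.single v 1) w e = edgeDiff w e v := by
  simp only [sqLen, edgeDiff, Pi.single_apply, ite_mul, one_mul, zero_mul, Finset.sum_ite_eq']
  split_ifs <;> ring

end sqLen

/-- Polarized squared lengths, as a bilinear map. -/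
noncomputable def sqLenBilin (V : Finset ℕ) (E : Finset (Finset ℕ)) :
    (V → ℝ) →L[ℝ] (V → ℝ) →L[ℝ] (E → ℝ) :=
  ((LinearMap.mk₂ ℝ (fun (z w : ℕ → ℝ) (e : E) => sqLen z w e.1)
    (fun _ _ _ => funext fun _ => sqLen_add_left _ _ _ _)
    (fun _ _ _ => funext fun _ => sqLen_smul_left _ _ _ _)
    (fun _ _ _ => funext fun _ => sqLen_add_right _ _ _ _)
    (fun _ _ _ => funext fun _ => sqLen_smul_right _ _ _ _)).compl₁₂
    (Function.ExtendByZero.linearMap ℝ Subtype.val)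
    (Function.ExtendByZero.linearMap ℝ Subtype.val)).toContinuousBilinearMap

theorem sqLenBilin_apply (V : Finset ℕ) (E : Finset (Finset ℕ)) (z w : V → ℝ) (e : E) :
    sqLenBilin V E z w e =
      sqLen (Function.extend Subtype.val z 0) (Function.extend Subtype.val w 0) e.1 := by
  rfl

/-- At a stress-free realization the length map is open. -/
theorem StressFree.map_sqLenBilin_nhds {V : Finset ℕ} {E : Finset (Finset ℕ)} {z w : ℕ → ℝ}
    (h : StressFree E z w) (hsub : ∀ e ∈ E, e ⊆ V) :
    Filter.map (fun x : (V → ℝ) × (V → ℝ) => sqLenBilin V E x.1 x.2)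
        (𝓝 (fun v => z v.1, fun v => w v.1)) =
      𝓝 (sqLenBilin V E (fun v => z v.1) (fun v => w v.1)) := by
  classical
  have hb := (sqLenBilin V E).isBoundedBilinearMap
  refine (hb.hasStrictFDerivAt _).map_nhds_eq_of_surj ?_
  by_contra hne
  obtain ⟨f, hf0, hf⟩ := Submodule.exists_le_ker_of_lt_top _ (lt_top_iff_ne_top.2 hne)
  have hext : ∀ (y : ℕ → ℝ), ∀ e ∈ E, ∀ u ∈ e,
      Function.extend Subtype.val (fun v : V => y v.1) 0 u = y u := fun y e he u hu =>
    Subtype.val_injective.extend_apply (fun v : V => y v.1) 0 ⟨u, hsub e he hu⟩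
  have hdir : ∀ p q : ℕ → ℝ, ∑ e : E, (sqLen z q e.1 + sqLen p w e.1) * f (Pi.single e 1) = 0 := by
    intro p q
    have h0 : f (hb.deriv (fun v => z v.1, fun v => w v.1) (fun v => p v.1, fun v => q v.1)) = 0 :=
      hf ⟨_, rfl⟩
    rw [LinearMap.pi_apply_eq_sum_univ f] at h0
    rw [← h0]
    refine Finset.sum_congr rfl fun e _ => ?_
    have h1 : (fun j => if e = j then (1 : ℝ) else 0) = Pi.single e 1 := by
      ext j
      simp [Pi.single_apply, eq_comm]
    rw [h1, smul_eq_mul]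
    congr 1
    change _ = sqLenBilin V E (fun v => z v.1) (fun v => q v.1) e +
      sqLenBilin V E (fun v => p v.1) (fun v => w v.1) e
    rw [sqLenBilin_apply, sqLenBilin_apply]
    congr 1 <;> exact sqLen_congr (fun u hu => (hext _ e.1 e.2 u hu).symm)
      (fun u hu => (hext _ e.1 e.2 u hu).symm)
  have hω : ∀ e ∈ E, (if he : e ∈ E then f (Pi.single ⟨e, he⟩ 1) else 0) = 0 := by
    refine h (fun e => if he : e ∈ E then f (Pi.single ⟨e, he⟩ 1) else 0)
      (fun v => ?_) (fun v => ?_)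
    · rw [← hdir 0 (Pi.single v 1), ← Finset.sum_coe_sort]
      refine Finset.sum_congr rfl fun e _ => ?_
      rw [sqLen_comm z, sqLen_single_left]
      simp [sqLen, mul_comm]
    · rw [← hdir (Pi.single v 1) 0, ← Finset.sum_coe_sort]
      refine Finset.sum_congr rfl fun e _ => ?_
      rw [sqLen_single_left]
      simp [sqLen, mul_comm]
  refine hf0 (LinearMap.pi_ext' fun e => LinearMap.ext_ring ?_)
  simpa using hω e.1 e.2

theorem MvPolynomial.eq_zero_of_eventually_nhds {τ : Type*} [Finite τ] {p : MvPolynomial τ ℝ}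
    {x : τ → ℝ} (h : ∀ᶠ y in 𝓝 x, eval y p = 0) : p = 0 := by
  rw [nhds_pi, Filter.Eventually, Filter.mem_pi] at h
  obtain ⟨I, -, t, ht, hsub⟩ := h
  refine funext_set t (fun i => infinite_of_mem_nhds _ (ht i)) fun y hy => ?_
  rw [map_zero]
  exact hsub fun i _ => hy i trivial

/-- The edge lengths of a generic realization of a sparse graph are algebraically independent. -/
theorem LamanSparse.algebraicIndependent_sqLen {V : Finset ℕ} {E : Finset (Finset ℕ)}
    (hE : LamanSparse E) (hsub : ∀ e ∈ E, e ⊆ V) (h2 : ∀ e ∈ E, e.card = 2) {z w : ℕ → ℂ}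
    (hzw : AlgebraicIndependent ℚ (Sum.elim (fun v : V => z v.1) (fun v : V => w v.1))) :
    AlgebraicIndependent ℚ (fun e : E => sqLen z w e.1) := by
  obtain ⟨z₀, w₀, h₀⟩ := hE.exists_stressFree hsub h2
  let Z : ℕ → MvPolynomial (V ⊕ V) ℚ :=
    Function.extend Subtype.val (fun v => MvPolynomial.X (Sum.inl v)) 0
  let W : ℕ → MvPolynomial (V ⊕ V) ℚ :=
    Function.extend Subtype.val (fun v => MvPolynomial.X (Sum.inr v)) 0
  have hZ : ∀ v : V, Z v.1 = MvPolynomial.X (Sum.inl v) :=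
    fun v => Subtype.val_injective.extend_apply _ _ v
  have hW : ∀ v : V, W v.1 = MvPolynomial.X (Sum.inr v) :=
    fun v => Subtype.val_injective.extend_apply _ _ v
  have haev : ∀ {A : Type} [CommRing A] [Algebra ℚ A] (p q : ℕ → A) (e : E),
      MvPolynomial.aeval (Sum.elim (fun v : V => p v.1) (fun v : V => q v.1)) (sqLen Z W e.1) =
        sqLen p q e.1 := by
    intro A _ _ p q e
    refine (map_sqLen (MvPolynomial.aeval (R := ℚ) _).toRingHom _ _ _).trans
      (sqLen_congr (fun u hu => ?_) (fun u hu => ?_))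
    · simp [hZ ⟨u, hsub e.1 e.2 hu⟩]
    · simp [hW ⟨u, hsub e.1 e.2 hu⟩]
  have hpoly : AlgebraicIndependent ℚ (fun e : E => sqLen Z W e.1) := by
    rw [algebraicIndependent_iff]
    intro P hP
    have hreal : ∀ p q : V → ℝ, MvPolynomial.eval (sqLenBilin V E p q)
        (MvPolynomial.map (algebraMap ℚ ℝ) P) = 0 := by
      intro p q
      have := congrArg (MvPolynomial.aeval (Sum.elim p q)) hP
      rw [map_zero, MvPolynomial.comp_aeval_apply] at this
      rw [MvPolynomial.eval_map, ← MvPolynomial.aeval_def, ← this]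
      congr 2
      funext e
      rw [sqLenBilin_apply, ← haev]
      congr 2
      ext (v | v) <;> simp
    have hev := MvPolynomial.eq_zero_of_eventually_nhds
      (x := sqLenBilin V E (fun v => z₀ v.1) (fun v => w₀ v.1))
      (p := MvPolynomial.map (algebraMap ℚ ℝ) P) (by
        rw [← h₀.map_sqLenBilin_nhds hsub, Filter.eventually_map]
        exact Filter.Eventually.of_forall fun x => hreal x.1 x.2)
    exact MvPolynomial.map_injective _ (algebraMap ℚ ℝ).injective (hev.trans (map_zero _).symm)
  have := hpoly.map' (f := MvPolynomial.aeval
    (Sum.elim (fun v : V => z v.1) (fun v : V => w v.1))) hzw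
  convert this using 1
  funext e
  exact (haev z w e).symm

/-- The first isotropic coordinate of a plane realization. -/
noncomputable def isoZ (ρ : ℕ → Fin 2 → ℂ) (v : ℕ) : ℂ := ρ v 0 + Complex.I * ρ v 1

/-- The second isotropic coordinate of a plane realization. -/
noncomputable def isoW (ρ : ℕ → Fin 2 → ℂ) (v : ℕ) : ℂ := ρ v 0 - Complex.I * ρ v 1

/-- The plane realization with given isotropic coordinates. -/
noncomputable def ofIso (z w : ℕ → ℂ) (v : ℕ) : Fin 2 → ℂ :=
  ![(z v + w v) / 2, -Complex.I * (z v - w v) / 2]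

@[simp] theorem isoZ_ofIso (z w : ℕ → ℂ) : isoZ (ofIso z w) = z := by
  funext v
  simp only [isoZ, ofIso, Matrix.cons_val_zero, Matrix.cons_val_one]
  linear_combination -(z v - w v) / 2 * Complex.I_sq

@[simp] theorem isoW_ofIso (z w : ℕ → ℂ) : isoW (ofIso z w) = w := by
  funext v
  simp only [isoW, ofIso, Matrix.cons_val_zero, Matrix.cons_val_one]
  linear_combination (z v - w v) / 2 * Complex.I_sq

theorem ofIso_iso (ρ : ℕ → Fin 2 → ℂ) : ofIso (isoZ ρ) (isoW ρ) = ρ := by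
  funext v i
  fin_cases i
  · simp [ofIso, isoZ, isoW]
  · simp only [ofIso, isoZ, isoW]
    simp
    linear_combination -(ρ v 1) * Complex.I_sq

theorem planeInduces_iff {G : GeoGraph} {ρ : ℕ → Fin 2 → ℂ} {lam : Finset ℕ → ℝ} :
    PlaneInduces G ρ lam ↔ ∀ e ∈ G.E, sqLen (isoZ ρ) (isoW ρ) e = (lam e : ℂ) := by
  have key : ∀ u v : ℕ, u ≠ v →
      ∑ i, (ρ u i - ρ v i) ^ 2 = sqLen (isoZ ρ) (isoW ρ) {u, v} := by
    intro u v huv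
    rw [sqLen_pair _ _ huv, Fin.sum_univ_two]
    unfold isoZ isoW
    linear_combination (ρ u 1 - ρ v 1) ^ 2 * Complex.I_sq
  constructor
  · intro h e he
    obtain ⟨u, v, huv, rfl⟩ := Finset.card_eq_two.1 (G.edge_two e he)
    rw [← key u v huv]
    exact h u v he
  · intro h u v he
    have huv : u ≠ v := by
      rintro rfl
      simpa using G.edge_two _ he
    rw [key u v huv]
    exact h _ he

/-- In isotropic coordinates, `SO₂(ℂ)` acts by scaling the coordinates by `t` and `t⁻¹`. -/
theorem planeCongruent_iff {G : GeoGraph} {ρ ρ' : ℕ → Fin 2 → ℂ} :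
    PlaneCongruent G ρ ρ' ↔ ∃ t : ℂ, t ≠ 0 ∧ ∃ c d : ℂ,
      ∀ v ∈ G.V, isoZ ρ' v = t * isoZ ρ v + c ∧ isoW ρ' v = t⁻¹ * isoW ρ v + d := by
  constructor
  · rintro ⟨A, b, hA, hdet, h⟩
    rw [Matrix.det_fin_two] at hdet
    have h00 : A 0 0 * A 0 0 + A 0 1 * A 0 1 = 1 := by
      simpa [Matrix.mul_apply, Fin.sum_univ_two] using congrFun (congrFun hA 0) 0
    have h01 : A 0 0 * A 1 0 + A 0 1 * A 1 1 = 0 := by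
      simpa [Matrix.mul_apply, Fin.sum_univ_two] using congrFun (congrFun hA 0) 1
    have h11 : A 1 0 * A 1 0 + A 1 1 * A 1 1 = 1 := by
      simpa [Matrix.mul_apply, Fin.sum_univ_two] using congrFun (congrFun hA 1) 1
    have e1 : A 1 1 = A 0 0 := by
      linear_combination -A 1 1 * h00 + A 0 0 * hdet + A 0 1 * h01
    have e2 : A 0 1 = -A 1 0 := by
      linear_combination -A 0 1 * h11 + A 1 1 * h01 - A 1 0 * hdet
    have hinv : (A 0 0 + Complex.I * A 1 0) * (A 0 0 - Complex.I * A 1 0) = 1 := by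
      rw [e2] at h00
      linear_combination h00 - A 1 0 ^ 2 * Complex.I_sq
    refine ⟨A 0 0 + Complex.I * A 1 0, left_ne_zero_of_mul_eq_one hinv,
      b 0 + Complex.I * b 1, b 0 - Complex.I * b 1, fun v hv => ?_⟩
    rw [← eq_inv_of_mul_eq_one_right hinv]
    have hv0 := congrFun (h v hv) 0
    have hv1 := congrFun (h v hv) 1
    simp only [Pi.add_apply, Matrix.mulVec, dotProduct, Fin.sum_univ_two, e1, e2] at hv0 hv1
    unfold isoZ isoW
    rw [hv0, hv1]
    constructor
    · linear_combination -A 1 0 * ρ v 1 * Complex.I_sq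
    · linear_combination -A 1 0 * ρ v 1 * Complex.I_sq
  · rintro ⟨t, ht, c, d, h⟩
    refine ⟨!![(t + t⁻¹) / 2, Complex.I * (t - t⁻¹) / 2; -Complex.I * (t - t⁻¹) / 2, (t + t⁻¹) / 2],
      ![(c + d) / 2, -Complex.I * (c - d) / 2], ?_, ?_, fun v hv => ?_⟩
    · ext i j
      fin_cases i <;> fin_cases j <;>
        simp [Matrix.mul_apply, Fin.sum_univ_two] <;> field_simp <;> ring_nf <;>
        simp [Complex.I_sq] <;> ring
    · rw [Matrix.det_fin_two_of]
      field_simp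
      ring_nf
      simp [Complex.I_sq]
      ring
    · obtain ⟨hz, hw⟩ := h v hv
      rw [← ofIso_iso ρ', ← ofIso_iso ρ]
      ext i
      fin_cases i
      · simp [ofIso, hz, hw]
        linear_combination (t - t⁻¹) * (isoZ ρ v - isoW ρ v) / 4 * Complex.I_sq
      · simp [ofIso, hz, hw]
        ring

section Normalize

/-- The first isotropic coordinate, normalized to be `0` at `a` and `1` at `b`. -/
noncomputable def normZ (z : ℕ → ℂ) (a b v : ℕ) : ℂ := (z v - z a) / (z b - z a)

/-- The second isotropic coordinate, normalized to be `0` at `a`, with the scaling inverse to that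
of `normZ`. -/
noncomputable def normW (z w : ℕ → ℂ) (a b v : ℕ) : ℂ := (w v - w a) * (z b - z a)

variable {z w : ℕ → ℂ} {a b : ℕ}

theorem normZ_left : normZ z a b a = 0 := by simp [normZ]

theorem normZ_right (h : z a ≠ z b) : normZ z a b b = 1 := div_self (sub_ne_zero.2 h.symm)

theorem normW_left : normW z w a b a = 0 := by simp [normW]

theorem sqLen_norm (h : z a ≠ z b) {e : Finset ℕ} (he : e.card = 2) :
    sqLen (normZ z a b) (normW z w a b) e = sqLen z w e := by
  obtain ⟨u, v, huv, rfl⟩ := Finset.card_eq_two.1 he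
  have := sub_ne_zero.2 h.symm
  rw [sqLen_pair _ _ huv, sqLen_pair _ _ huv]
  unfold normZ normW
  field_simp
  ring

theorem map_normZ (σ : ℂ ≃+* ℂ) (v : ℕ) :
    σ (normZ z a b v) = normZ (fun v => σ (z v)) a b v := by simp [normZ]

theorem map_normW (σ : ℂ ≃+* ℂ) (v : ℕ) :
    σ (normW z w a b v) = normW (fun v => σ (z v)) (fun v => σ (w v)) a b v := by simp [normW]

end Normalize

theorem algHull_le {s t : Set ℂ} (h : s ⊆ algHull t) : algHull s ≤ algHull t := by
  rw [coe_algHull] at h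
  rw [← SetLike.coe_subset_coe, coe_algHull, coe_algHull]
  exact Matroid.closure_subset_closure_of_subset_closure h

theorem sqLen_mem (K : IntermediateField ℚ ℂ) {z w : ℕ → ℂ} {e : Finset ℕ}
    (hz : ∀ v ∈ e, z v ∈ K) (hw : ∀ v ∈ e, w v ∈ K) : sqLen z w e ∈ K :=
  sub_mem (mul_mem (ofNat_mem K 2) (sum_mem fun v hv => mul_mem (hz v hv) (hw v hv)))
    (mul_mem (sum_mem hz) (sum_mem hw))

/-- The coordinates of a normalized realization of `V` involve at most `2|V| - 3` parameters. -/
theorem exists_coordinates {V : Finset ℕ} {a b : ℕ} (ha : a ∈ V) (hb : b ∈ V) (hab : a ≠ b)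
    {z w : ℕ → ℂ} (hza : z a = 0) (hzb : z b = 1) (hwa : w a = 0) :
    ∃ T : Finset ℂ, T.card + 3 ≤ 2 * V.card ∧
      ∀ v ∈ V, z v ∈ algHull T ∧ w v ∈ algHull T := by
  classical
  refine ⟨((V.erase a).erase b).image z ∪ (V.erase a).image w, ?_, fun v hv => ⟨?_, ?_⟩⟩
  · have h1 := Finset.card_union_le (((V.erase a).erase b).image z) ((V.erase a).image w)
    have h2 : (((V.erase a).erase b).image z).card ≤ _ := Finset.card_image_le
    have h3 : ((V.erase a).image w).card ≤ _ := Finset.card_image_le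
    have h4 := Finset.card_erase_add_one ha
    have h5 := Finset.card_erase_add_one (Finset.mem_erase.2 ⟨hab.symm, hb⟩)
    omega
  · by_cases hva : v = a
    · rw [hva, hza]; exact zero_mem _
    by_cases hvb : v = b
    · rw [hvb, hzb]; exact one_mem _
    exact subset_algHull _ (Finset.mem_coe.2 (Finset.mem_union_left _
      (Finset.mem_image_of_mem _ (by simp [hva, hvb, hv]))))
  · by_cases hva : v = a
    · rw [hva, hwa]; exact zero_mem _
    exact subset_algHull _ (Finset.mem_coe.2 (Finset.mem_union_right _
      (Finset.mem_image_of_mem _ (by simp [hva, hv]))))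

theorem card_le_of_algebraicIndependent_sqLen {V : Finset ℕ} {E : Finset (Finset ℕ)}
    (hsub : ∀ e ∈ E, e ⊆ V) (h2 : ∀ e ∈ E, e.card = 2) {z w : ℕ → ℂ}
    (hE : AlgebraicIndependent ℚ fun e : E => sqLen z w e.1) (hV : 2 ≤ V.card) :
    E.card + 3 ≤ 2 * V.card := by
  rcases E.eq_empty_or_nonempty with rfl | ⟨e, he⟩
  · simp; omega
  obtain ⟨a, b, hab, rfl⟩ := Finset.card_eq_two.1 (h2 _ he)
  have hz : z a ≠ z b := by
    intro h
    refine hE.ne_zero ⟨_, he⟩ ?_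
    rw [sqLen_pair _ _ hab, h, sub_self, zero_mul]
  obtain ⟨T, hT, hmem⟩ := exists_coordinates (hsub _ he (by simp : a ∈ _))
    (hsub _ he (by simp : b ∈ _)) hab (z := normZ z a b) (w := normW z w a b)
    normZ_left (normZ_right hz) normW_left
  have := hE.card_le_of_mem_algHull (s := T) fun e => by
    rw [← sqLen_norm hz (h2 e.1 e.2)]
    exact sqLen_mem _ (fun v hv => (hmem v (hsub e.1 e.2 hv)).1)
      (fun v hv => (hmem v (hsub e.1 e.2 hv)).2)
  rw [Set.encard_coe_eq_coe_finsetCard, Nat.card_eq_fintype_card, Fintype.card_coe] at this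
  norm_cast at this
  omega

/-- If the edge lengths are algebraically independent and as many as possible, then all
normalized coordinates are algebraic over them. -/
theorem mem_algHull_of_algebraicIndependent_sqLen {V : Finset ℕ} {E : Finset (Finset ℕ)}
    (hsub : ∀ e ∈ E, e ⊆ V) {a b : ℕ} (ha : a ∈ V) (hb : b ∈ V) (hab : a ≠ b)
    {z w : ℕ → ℂ} (hza : z a = 0) (hzb : z b = 1) (hwa : w a = 0)
    (hE : AlgebraicIndependent ℚ fun e : E => sqLen z w e.1) (hcard : 2 * V.card ≤ E.card + 3)
    {v : ℕ} (hv : v ∈ V) :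
    z v ∈ algHull (Set.range fun e : E => sqLen z w e.1) ∧
      w v ∈ algHull (Set.range fun e : E => sqLen z w e.1) := by
  obtain ⟨T, hT, hmem⟩ := exists_coordinates ha hb hab hza hzb hwa
  have hle := algHull_le (hE.subset_algHull_range (s := T)
    (fun e => sqLen_mem _ (fun v hv => (hmem v (hsub e.1 e.2 hv)).1)
      (fun v hv => (hmem v (hsub e.1 e.2 hv)).2)) (by
    rw [Set.encard_coe_eq_coe_finsetCard, Nat.card_eq_fintype_card, Fintype.card_coe]
    norm_cast
    omega))
  exact ⟨hle (hmem v hv).1, hle (hmem v hv).2⟩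

/-- If there are few edges, some normalized coordinate of a generic realization is
transcendental over the edge lengths. -/
theorem exists_notMem_algHull {V : Finset ℕ} {E : Finset (Finset ℕ)} {a b : ℕ} (ha : a ∈ V)
    (hb : b ∈ V) (hab : a ≠ b) {z w : ℕ → ℂ}
    (hzw : AlgebraicIndependent ℚ (Sum.elim (fun v : V => z v.1) (fun v : V => w v.1)))
    (hcard : E.card + 3 < 2 * V.card) :
    ∃ v ∈ V, normZ z a b v ∉ algHull (Set.range fun e : E => sqLen z w e.1) ∨
      normW z w a b v ∉ algHull (Set.range fun e : E => sqLen z w e.1) := by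
  classical
  by_contra! hcon
  have hz : z a ≠ z b := fun h => hab (by
    simpa using hzw.injective (a₁ := Sum.inl ⟨a, ha⟩) (a₂ := Sum.inl ⟨b, hb⟩) h)
  let T : Finset ℂ := {z a, z b, w a} ∪ E.image fun e => sqLen z w e
  have hTcard : T.card ≤ E.card + 3 := by
    have h1 := Finset.card_union_le {z a, z b, w a} (E.image fun e => sqLen z w e)
    have h2 : (E.image fun e => sqLen z w e).card ≤ _ := Finset.card_image_le
    have h3 := Finset.card_le_three (a := z a) (b := z b) (c := w a)
    change T.card ≤ _ at h1
    omega
  have hmem : ∀ x ∈ ({z a, z b, w a} : Finset ℂ), x ∈ algHull T := fun x hx =>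
    subset_algHull _ (Finset.mem_coe.2 (Finset.mem_union_left _ hx))
  have hle : algHull (Set.range fun e : E => sqLen z w e.1) ≤ algHull T := by
    refine algHull_le ?_
    rintro _ ⟨e, rfl⟩
    exact subset_algHull _ (Finset.mem_coe.2 (Finset.mem_union_right _
      (Finset.mem_image_of_mem _ e.2)))
  have hd : z b - z a ≠ 0 := sub_ne_zero.2 hz.symm
  have hdm : z b - z a ∈ algHull T := sub_mem (hmem _ (by simp)) (hmem _ (by simp))
  have := hzw.card_le_of_mem_algHull (s := T) (by
    rintro (v | v)
    · have : z v.1 = normZ z a b v.1 * (z b - z a) + z a := by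
        rw [normZ, div_mul_cancel₀ _ hd, sub_add_cancel]
      rw [Sum.elim_inl, this]
      exact add_mem (mul_mem (hle (hcon v.1 v.2).1) hdm) (hmem _ (by simp))
    · have : w v.1 = normW z w a b v.1 / (z b - z a) + w a := by
        rw [normW, mul_div_cancel_right₀ _ hd, sub_add_cancel]
      rw [Sum.elim_inr, this]
      exact add_mem (div_mem (hle (hcon v.1 v.2).2) hdm) (hmem _ (by simp)))
  rw [Set.encard_coe_eq_coe_finsetCard, Nat.card_eq_fintype_card, Fintype.card_sum,
    Fintype.card_coe] at this
  norm_cast at this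
  omega

section PlaneCoords

variable {G : GeoGraph} {ρ ρ' : ℕ → Fin 2 → ℂ} {lam : Finset ℕ → ℝ} {a b : ℕ}

theorem PlaneCongruent.norm_eq (h : PlaneCongruent G ρ ρ') (ha : a ∈ G.V) (hb : b ∈ G.V)
    {v : ℕ} (hv : v ∈ G.V) :
    normZ (isoZ ρ) a b v = normZ (isoZ ρ') a b v ∧
      normW (isoZ ρ) (isoW ρ) a b v = normW (isoZ ρ') (isoW ρ') a b v := by
  obtain ⟨t, ht, c, d, h⟩ := planeCongruent_iff.1 h
  unfold normZ normW
  rw [(h a ha).1, (h a ha).2, (h b hb).1, (h v hv).1, (h v hv).2, add_sub_add_right_eq_sub,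
    add_sub_add_right_eq_sub, add_sub_add_right_eq_sub, ← mul_sub, ← mul_sub, ← mul_sub,
    mul_div_mul_left _ _ ht]
  refine ⟨rfl, ?_⟩
  field_simp

theorem planeCongruent_of_norm_eq (hρ : isoZ ρ a ≠ isoZ ρ b) (hρ' : isoZ ρ' a ≠ isoZ ρ' b)
    (h : ∀ v ∈ G.V, normZ (isoZ ρ) a b v = normZ (isoZ ρ') a b v ∧
      normW (isoZ ρ) (isoW ρ) a b v = normW (isoZ ρ') (isoW ρ') a b v) :
    PlaneCongruent G ρ ρ' := by
  have hd := sub_ne_zero.2 hρ.symm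
  have hd' := sub_ne_zero.2 hρ'.symm
  obtain ⟨t, ht⟩ : ∃ t, t = (isoZ ρ' b - isoZ ρ' a) / (isoZ ρ b - isoZ ρ a) := ⟨_, rfl⟩
  have ht0 : t ≠ 0 := ht ▸ div_ne_zero hd' hd
  refine planeCongruent_iff.2 ⟨t, ht0, isoZ ρ' a - t * isoZ ρ a, isoW ρ' a - t⁻¹ * isoW ρ a,
    fun v hv => ?_⟩
  obtain ⟨hz, hw⟩ := h v hv
  unfold normZ at hz
  unfold normW at hw
  rw [div_eq_div_iff hd hd'] at hz
  constructor
  · have : isoZ ρ' v - isoZ ρ' a = t * (isoZ ρ v - isoZ ρ a) := by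
      rw [ht, div_mul_eq_mul_div, eq_div_iff hd]
      linear_combination -hz
    linear_combination this
  · have : isoW ρ' v - isoW ρ' a = t⁻¹ * (isoW ρ v - isoW ρ a) := by
      rw [ht, inv_div, div_mul_eq_mul_div, eq_div_iff hd']
      linear_combination -hw
    linear_combination this

/-- The normalized coordinates of a congruence class of plane realizations. -/
noncomputable def planeCoords (lam : Finset ℕ → ℝ) (ha : a ∈ G.V) (hb : b ∈ G.V) :
    PlaneClasses G lam → G.V ⊕ G.V → ℂ :=
  Quot.lift (fun ρ => Sum.elim (fun v => normZ (isoZ ρ.1) a b v.1)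
    (fun v => normW (isoZ ρ.1) (isoW ρ.1) a b v.1)) fun ρ ρ' h => by
      ext (v | v)
      exacts [(h.norm_eq ha hb v.2).1, (h.norm_eq ha hb v.2).2]

theorem PlaneInduces.isoZ_ne (h : PlaneInduces G ρ lam) (hab : a ≠ b) (hE : {a, b} ∈ G.E)
    (hlam : lam {a, b} ≠ 0) : isoZ ρ a ≠ isoZ ρ b := by
  intro hz
  have := planeInduces_iff.1 h _ hE
  rw [sqLen_pair _ _ hab, hz, sub_self, zero_mul] at this
  exact hlam (by exact_mod_cast this.symm)

theorem planeCoords_injective (ha : a ∈ G.V) (hb : b ∈ G.V) (hab : a ≠ b) (hE : {a, b} ∈ G.E)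
    (hlam : lam {a, b} ≠ 0) : Function.Injective (planeCoords lam ha hb) := by
  rintro ⟨ρ⟩ ⟨ρ'⟩ h
  refine Quot.sound (planeCongruent_of_norm_eq (ρ.2.isoZ_ne hab hE hlam)
    (ρ'.2.isoZ_ne hab hE hlam) fun v hv => ⟨?_, ?_⟩)
  · exact congrFun h (Sum.inl ⟨v, hv⟩)
  · exact congrFun h (Sum.inr ⟨v, hv⟩)

end PlaneCoords

theorem AlgebraicIndependent.ofReal {ι : Type*} {x : ι → ℝ} (hx : AlgebraicIndependent ℚ x) :
    AlgebraicIndependent ℚ fun i => (x i : ℂ) :=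
  hx.map' (f := Complex.ofRealAm.restrictScalars ℚ) Complex.ofReal_injective

theorem exists_generic_coords (V : Finset ℕ) : ∃ z w : ℕ → ℂ,
    AlgebraicIndependent ℚ (Sum.elim (fun v : V => z v.1) (fun v : V => w v.1)) := by
  obtain ⟨x, -, hx⟩ := exists_pos_algebraicIndependent (V ⊕ V)
  refine ⟨Function.extend Subtype.val (fun v => (x (Sum.inl v) : ℂ)) 0,
    Function.extend Subtype.val (fun v => (x (Sum.inr v) : ℂ)) 0, ?_⟩
  convert hx.ofReal using 1
  ext (v | v) <;> simp

theorem exists_generic_lengths (G : GeoGraph) : ∃ lam, Generic G lam := by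
  obtain ⟨x, hpos, hx⟩ := exists_pos_algebraicIndependent G.E
  have hval : ∀ e : G.E, Function.extend Subtype.val x 1 e.1 = x e :=
    Subtype.val_injective.extend_apply x 1
  refine ⟨Function.extend Subtype.val x 1, fun e he => ?_, ?_⟩
  · rw [hval ⟨e, he⟩]
    exact hpos _
  · simpa only [hval] using hx

theorem planeInduces_ofIso_map {G : GeoGraph} {lam : Finset ℕ → ℝ} {z w : ℕ → ℂ} (σ : ℂ ≃+* ℂ)
    (h : ∀ e : G.E, σ (sqLen z w e.1) = (lam e.1 : ℂ)) :
    PlaneInduces G (ofIso (fun v => σ (z v)) (fun v => σ (w v))) lam := by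
  refine planeInduces_iff.2 fun e he => ?_
  rw [isoZ_ofIso, isoW_ofIso, ← h ⟨e, he⟩]
  exact (map_sqLen σ.toRingHom z w e).symm

theorem Laman.lamanSparse {G : GeoGraph} (h : Laman G) : LamanSparse G.E := by
  intro S hS
  by_cases hcard : 2 ≤ (S ∩ G.V).card
  · have h1 := h.2.2 ⟨S ∩ G.V, spannedEdges G.E S,
      fun e he => Finset.subset_inter (mem_spannedEdges.1 he).2
        (G.edge_sub e (mem_spannedEdges.1 he).1),
      fun e he => G.edge_two e (mem_spannedEdges.1 he).1⟩
      ⟨Finset.inter_subset_right, Finset.filter_subset _ _⟩ hcard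
    have h2 : (S ∩ G.V).card ≤ S.card := Finset.card_le_card Finset.inter_subset_left
    dsimp only at h1
    omega
  · have : spannedEdges G.E S = ∅ := by
      refine Finset.eq_empty_of_forall_notMem fun e he => hcard ?_
      rw [mem_spannedEdges] at he
      rw [← G.edge_two e he.1]
      exact Finset.card_le_card (Finset.subset_inter he.2 (G.edge_sub e he.1))
    rw [this, Finset.card_empty]
    omega

theorem LamanSparse.nonempty_planeClasses {G : GeoGraph} (hG : LamanSparse G.E)
    {lam : Finset ℕ → ℝ} (hlam : Generic G lam) : Nonempty (PlaneClasses G lam) := by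
  obtain ⟨z, w, hzw⟩ := exists_generic_coords G.V
  obtain ⟨σ, hσ⟩ :=
    (hG.algebraicIndependent_sqLen G.edge_sub G.edge_two hzw).exists_ringEquiv hlam.2.ofReal
  exact ⟨Quot.mk _ ⟨_, planeInduces_ofIso_map σ hσ⟩⟩

theorem finite_planeClasses {G : GeoGraph} (hV : 2 ≤ G.V.card)
    (hcard : 2 * G.V.card ≤ G.E.card + 3) {lam : Finset ℕ → ℝ} (hlam : Generic G lam) :
    Finite (PlaneClasses G lam) := by
  classical
  obtain ⟨e₀, he₀⟩ : G.E.Nonempty := Finset.card_pos.1 (by omega)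
  obtain ⟨a, b, hab, rfl⟩ := Finset.card_eq_two.1 (G.edge_two _ he₀)
  have ha : a ∈ G.V := G.edge_sub _ he₀ (by simp)
  have hb : b ∈ G.V := G.edge_sub _ he₀ (by simp)
  have hne : lam {a, b} ≠ 0 := (hlam.1 _ he₀).ne'
  let Z : ℕ → MvPolynomial (G.V ⊕ G.V) ℂ :=
    Function.extend Subtype.val (fun v => MvPolynomial.X (Sum.inl v)) 0
  let W : ℕ → MvPolynomial (G.V ⊕ G.V) ℂ :=
    Function.extend Subtype.val (fun v => MvPolynomial.X (Sum.inr v)) 0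
  have hZ : ∀ v (hv : v ∈ G.V), Z v = MvPolynomial.X (Sum.inl ⟨v, hv⟩) :=
    fun v hv => Subtype.val_injective.extend_apply _ _ (⟨v, hv⟩ : G.V)
  have hW : ∀ v (hv : v ∈ G.V), W v = MvPolynomial.X (Sum.inr ⟨v, hv⟩) :=
    fun v hv => Subtype.val_injective.extend_apply _ _ (⟨v, hv⟩ : G.V)
  let I : Ideal (MvPolynomial (G.V ⊕ G.V) ℂ) := Ideal.span ({Z a, Z b - 1, W a} ∪
    Set.range fun e : G.E => sqLen Z W e.1 - MvPolynomial.C (lam e.1 : ℂ))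
  have hI : ∀ (z w : ℕ → ℂ),
      Sum.elim (fun v : G.V => z v.1) (fun v : G.V => w v.1) ∈ MvPolynomial.zeroLocus ℂ I ↔
      z a = 0 ∧ z b = 1 ∧ w a = 0 ∧ ∀ e : G.E, sqLen z w e.1 = (lam e.1 : ℂ) := by
    intro z w
    have hlen : ∀ e : G.E, MvPolynomial.aeval
        (Sum.elim (fun v : G.V => z v.1) (fun v : G.V => w v.1)) (sqLen Z W e.1) =
          sqLen z w e.1 := by
      intro e
      refine (map_sqLen (MvPolynomial.aeval (R := ℂ) _).toRingHom _ _ _).trans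
        (sqLen_congr (fun u hu => ?_) (fun u hu => ?_))
      · simp [hZ u (G.edge_sub _ e.2 hu)]
      · simp [hW u (G.edge_sub _ e.2 hu)]
    simp only [I, MvPolynomial.zeroLocus_span, Set.mem_ofPred_eq, Set.mem_union, or_imp,
      forall_and, Set.mem_insert_iff, Set.mem_singleton_iff, forall_eq, Set.forall_mem_range,
      hZ a ha, hZ b hb, hW a ha, map_sub, map_one, MvPolynomial.aeval_X, Sum.elim_inl,
      Sum.elim_inr, hlen, MvPolynomial.aeval_C, Algebra.algebraMap_self, RingHom.id_apply,
      sub_eq_zero, and_assoc]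
  have hcount : (MvPolynomial.zeroLocus ℂ I).Countable := by
    refine (Set.countable_univ_pi fun _ : G.V ⊕ G.V => countable_algHull
      (Set.finite_range fun e : G.E => (lam e.1 : ℂ))).mono fun x hx => ?_
    obtain ⟨z, hz⟩ : ∃ z : ℕ → ℂ, ∀ v : G.V, z v.1 = x (Sum.inl v) :=
      ⟨Function.extend Subtype.val (fun v => x (Sum.inl v)) 0,
        Subtype.val_injective.extend_apply _ _⟩
    obtain ⟨w, hw⟩ : ∃ w : ℕ → ℂ, ∀ v : G.V, w v.1 = x (Sum.inr v) :=
      ⟨Function.extend Subtype.val (fun v => x (Sum.inr v)) 0,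
        Subtype.val_injective.extend_apply _ _⟩
    have hx' : x = Sum.elim (fun v : G.V => z v.1) (fun v : G.V => w v.1) := by
      ext (v | v) <;> simp [hz, hw]
    rw [hx', hI] at hx
    obtain ⟨hza, hzb, hwa, hlen⟩ := hx
    have hfun : (fun e : G.E => sqLen z w e.1) = fun e : G.E => (lam e.1 : ℂ) := funext hlen
    have key : ∀ v ∈ G.V, _ := fun v hv => mem_algHull_of_algebraicIndependent_sqLen G.edge_sub
      ha hb hab hza hzb hwa (hfun ▸ hlam.2.ofReal) hcard hv
    rw [hfun] at key
    rw [hx']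
    rintro (v | v) -
    exacts [(key v.1 v.2).1, (key v.1 v.2).2]
  have := (finite_zeroLocus_of_countable I hcount).to_subtype
  have hmem : ∀ p, planeCoords lam ha hb p ∈ MvPolynomial.zeroLocus ℂ I := by
    rintro ⟨ρ⟩
    have hz := ρ.2.isoZ_ne hab he₀ hne
    refine (hI (normZ (isoZ ρ.1) a b) (normW (isoZ ρ.1) (isoW ρ.1) a b)).2
      ⟨normZ_left, normZ_right hz, normW_left, fun e => ?_⟩
    rw [sqLen_norm hz (G.edge_two e.1 e.2)]
    exact planeInduces_iff.1 ρ.2 e.1 e.2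
  exact Finite.of_injective (fun p => (⟨_, hmem p⟩ : MvPolynomial.zeroLocus ℂ I)) fun p q h =>
    planeCoords_injective ha hb hab he₀ hne (Subtype.ext_iff.1 h)

theorem infinite_planeClasses {G : GeoGraph} (hG : LamanSparse G.E) (hV : 2 ≤ G.V.card)
    (hcard : G.E.card + 3 < 2 * G.V.card) {lam : Finset ℕ → ℝ} (hlam : Generic G lam) :
    Infinite (PlaneClasses G lam) := by
  obtain ⟨a, ha, b, hb, hab⟩ := Finset.one_lt_card.1 hV
  obtain ⟨z, w, hzw⟩ := exists_generic_coords G.V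
  have hL := hG.algebraicIndependent_sqLen G.edge_sub G.edge_two hzw
  have hlift : ∀ x, x ∉ algHull (Set.range fun e : G.E => sqLen z w e.1) →
      ∀ y, y ∉ algHull (Set.range fun e : G.E => (lam e.1 : ℂ)) →
      ∃ σ : ℂ ≃+* ℂ, σ x = y ∧ ∀ e : G.E, σ (sqLen z w e.1) = (lam e.1 : ℂ) := by
    intro x hx y hy
    obtain ⟨σ, hσ⟩ := ((hL.option_iff_transcendental x).2 hx).exists_ringEquiv
      ((hlam.2.ofReal.option_iff_transcendental y).2 hy)
    exact ⟨σ, hσ none, fun e => hσ (some e)⟩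
  obtain ⟨i, hi⟩ : ∃ i : G.V ⊕ G.V, ∀ y, y ∉ algHull (Set.range fun e : G.E => (lam e.1 : ℂ)) →
      ∃ p, planeCoords lam ha hb p i = y := by
    obtain ⟨v, hv, h | h⟩ := exists_notMem_algHull ha hb hab hzw hcard
    · refine ⟨Sum.inl ⟨v, hv⟩, fun y hy => ?_⟩
      obtain ⟨σ, hx, hσ⟩ := hlift _ h y hy
      refine ⟨Quot.mk _ ⟨_, planeInduces_ofIso_map σ hσ⟩, ?_⟩
      rw [← hx, map_normZ]
      simp [planeCoords]
    · refine ⟨Sum.inr ⟨v, hv⟩, fun y hy => ?_⟩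
      obtain ⟨σ, hx, hσ⟩ := hlift _ h y hy
      refine ⟨Quot.mk _ ⟨_, planeInduces_ofIso_map σ hσ⟩, ?_⟩
      rw [← hx, map_normW]
      simp [planeCoords]
  refine not_finite_iff_infinite.1 fun hfin => not_countable_complex ?_
  refine ((countable_algHull (Set.finite_range fun e : G.E => (lam e.1 : ℂ))).union
    (Set.finite_range fun p => planeCoords lam ha hb p i).countable).mono fun y _ => ?_
  by_cases hy : y ∈ algHull (Set.range fun e : G.E => (lam e.1 : ℂ))
  · exact Or.inl hy
  · exact Or.inr (hi y hy)

theorem PlaneInduces.lamanSparse {G : GeoGraph} {ρ : ℕ → Fin 2 → ℂ} {lam : Finset ℕ → ℝ}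
    (h : PlaneInduces G ρ lam) (hlam : Generic G lam) : LamanSparse G.E := by
  intro S hS
  refine card_le_of_algebraicIndependent_sqLen (z := isoZ ρ) (w := isoW ρ)
    (fun e he => (mem_spannedEdges.1 he).2)
    (fun e he => G.edge_two e (mem_spannedEdges.1 he).1) ?_ hS
  have hsub : spannedEdges G.E S ⊆ G.E := Finset.filter_subset _ _
  convert hlam.2.ofReal.comp (fun e : spannedEdges G.E S => (⟨e.1, hsub e.2⟩ : G.E))
    (fun x y hxy => Subtype.ext (congrArg (fun e : G.E => e.1) hxy)) using 1
  funext e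
  exact planeInduces_iff.1 h e.1 (hsub e.2)

/-- **Pollaczek-Geiringer–Laman theorem.** A graph with at least two vertices is
minimally rigid in the plane (finitely many but not zero congruence classes of
plane realizations for every generic edge-length assignment) iff it satisfies
the Laman counting conditions. -/
theorem minimally_rigid_iff_laman (G : GeoGraph) (hV : 2 ≤ G.V.card) :
    (∀ lam : Finset ℕ → ℝ, Generic G lam →
      Finite (PlaneClasses G lam) ∧ Nonempty (PlaneClasses G lam)) ↔ Laman G := by
  constructor
  · intro h
    obtain ⟨lam, hlam⟩ := exists_generic_lengths G
    obtain ⟨hfin, ⟨⟨ρ⟩⟩⟩ := h lam hlam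
    have hsparse := ρ.2.lamanSparse hlam
    have hcount : ∀ G' : GeoGraph, IsSubgraph G' G → 2 ≤ G'.V.card →
        G'.E.card + 3 ≤ 2 * G'.V.card := fun G' hG' hV' =>
      (Nat.add_le_add_right (Finset.card_le_card fun e he =>
        mem_spannedEdges.2 ⟨hG'.2 he, G'.edge_sub e he⟩) 3).trans (hsparse G'.V hV')
    have hupper := hcount G ⟨subset_rfl, subset_rfl⟩ hV
    have hlower : 2 * G.V.card ≤ G.E.card + 3 := by
      by_contra! hlt
      exact (infinite_planeClasses hsparse hV hlt hlam).not_finite hfin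
    exact ⟨hV, by omega, fun G' hG' hV' => by have := hcount G' hG' hV'; omega⟩
  · intro h lam hlam
    exact ⟨finite_planeClasses hV (by have := h.2.1; omega) hlam,
      h.lamanSparse.nonempty_planeClasses hlam⟩
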